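/- Let ω be a positive superharmonic function on the open unit disk 𝔻 and let Λ : 𝒟_ω → ℂ be a ℂ-linear functional (not assumed continuous) such that Λ(1) = 1 and Λ(g) ≠ 0 for every g ∈ 𝒟_ω with g(z) ≠ 0 for all z ∈ 𝔻. Then there exists w ∈ 𝔻 such that Λ(f) = f(w) for all f ∈ 𝒟_ω. -/

import Mathlib

open MeasureTheory

noncomputable section

/-- The open unit disk in `ℂ`. -/
def unitDisk : Set ℂ := Metric.ball 0 1

/-- A function on the unit disk is holomorphic if it extends to a function on `ℂ`
that is holomorphic on the disk. -/
def HolOn (f : unitDisk → ℂ) : Prop :=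
  ∃ F : ℂ → ℂ, DifferentiableOn ℂ F unitDisk ∧ ∀ z : unitDisk, f z = F z

/-- `ω : ℂ → ℝ` is superharmonic on the unit disk: lower semicontinuous there, and
satisfying the super-mean-value inequality
`(1/2π) ∫₀^{2π} ω(z₀ + r e^{iθ}) dθ ≤ ω z₀` whenever the closed disk of centre `z₀`
and radius `r > 0` is contained in the unit disk.  (The circle integral of the
positive function `ω` is taken as a lower Lebesgue integral.) -/
def SuperharmonicOn (ω : ℂ → ℝ) : Prop :=
  LowerSemicontinuousOn ω unitDisk ∧
  ∀ (z₀ : ℂ) (r : ℝ), 0 < r → Metric.closedBall z₀ r ⊆ unitDisk →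
    (∫⁻ θ in Set.Ioc (0 : ℝ) (2 * Real.pi),
        ENNReal.ofReal (ω (z₀ + (r : ℂ) * Complex.exp ((θ : ℂ) * Complex.I))))
      ≤ ENNReal.ofReal (2 * Real.pi * ω z₀)

/-- Membership in the weighted Dirichlet space `𝒟_ω`: `f` is holomorphic on the unit
disk and `∫_𝔻 |f′(z)|² ω(z) dA(z) < ∞`. -/
def dirichletMem (ω : ℂ → ℝ) (f : unitDisk → ℂ) : Prop :=
  ∃ F : ℂ → ℂ, DifferentiableOn ℂ F unitDisk ∧ (∀ z : unitDisk, f z = F z) ∧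
    (∫⁻ z in unitDisk, ENNReal.ofReal (‖deriv F z‖ ^ 2 * ω z)) < ⊤

/-- `F` is holomorphic on the unit disk with finite weighted Dirichlet integral. -/
def FiniteEnergy (ω : ℂ → ℝ) (F : ℂ → ℂ) : Prop :=
  DifferentiableOn ℂ F unitDisk ∧
    (∫⁻ z in unitDisk, ENNReal.ofReal (‖deriv F z‖ ^ 2 * ω z)) < ⊤

/-- A weight on the disk that is positive, measurable and area-integrable. -/
structure IsIntegrableWeight (ω : ℂ → ℝ) : Prop where
  pos : ∀ z ∈ unitDisk, 0 < ω z
  aemeasurable : AEMeasurable ω (volume.restrict unitDisk)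
  lintegral_lt_top : (∫⁻ z in unitDisk, ENNReal.ofReal (ω z)) < ⊤

theorem isOpen_unitDisk : IsOpen unitDisk := Metric.isOpen_ball

theorem measurableSet_unitDisk : MeasurableSet unitDisk := isOpen_unitDisk.measurableSet

theorem mem_unitDisk {z : ℂ} : z ∈ unitDisk ↔ ‖z‖ < 1 := by simp [unitDisk]

theorem Multiset.sum_map_sq_eq {R : Type*} [CommRing R] (s : Multiset R) :
    (s.map (· ^ 2)).sum = s.sum ^ 2 - 2 * s.esymm 2 := by
  induction s using Multiset.induction with
  | empty =>
    simp [Multiset.esymm,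
      (Multiset.powersetCard_zero_right 1 : Multiset.powersetCard 2 (0 : Multiset R) = 0)]
  | cons a s ih =>
    have h : (a ::ₘ s).esymm 2 = s.esymm 2 + a * s.sum := by
      have h1 : (s.map fun x => a * x).sum = a * s.sum := by
        simpa using Multiset.sum_map_mul_left (s := s) (a := a) (f := id)
      simp [Multiset.esymm, Multiset.powersetCard_cons, Multiset.powersetCard_one, h1]
    rw [h, Multiset.map_cons, Multiset.sum_cons, ih, Multiset.sum_cons]
    ring

theorem Polynomial.Monic.norm_coeff_sq_sub_le {p : Polynomial ℂ} (hp : p.Monic) {n : ℕ}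
    (hn : p.natDegree = n + 2) {B : ℝ} (hB : ∀ x ∈ p.roots, ‖x‖ ≤ B) :
    ‖p.coeff (n + 1) ^ 2 - 2 * p.coeff n‖ ≤ (n + 2) * B ^ 2 := by
  have hcard : p.roots.card = p.natDegree :=
    (IsAlgClosed.splits p).natDegree_eq_card_roots.symm
  have h1 : p.coeff (n + 1) = -p.roots.esymm 1 := by
    rw [Polynomial.coeff_eq_esymm_roots_of_card hcard (by omega), hn, hp.leadingCoeff,
      show n + 2 - (n + 1) = 1 by omega]
    simp
  have h2 : p.coeff n = p.roots.esymm 2 := by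
    rw [Polynomial.coeff_eq_esymm_roots_of_card hcard (by omega), hn, hp.leadingCoeff,
      show n + 2 - n = 2 by omega]
    simp
  have h3 : p.roots.esymm 1 = p.roots.sum := by
    simp [Multiset.esymm, Multiset.powersetCard_one]
  rw [h1, h2, neg_sq, h3, ← Multiset.sum_map_sq_eq]
  have h4 : ∀ s : Multiset ℂ, (∀ x ∈ s, ‖x‖ ≤ B) → ‖(s.map (· ^ 2)).sum‖ ≤ s.card * B ^ 2 := by
    intro s
    induction s using Multiset.induction with
    | empty => simp
    | cons a s ih =>
      intro h
      rw [Multiset.map_cons, Multiset.sum_cons, Multiset.card_cons]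
      have ha : ‖a ^ 2‖ ≤ B ^ 2 := by
        rw [norm_pow]
        exact pow_le_pow_left₀ (norm_nonneg _) (h a (by simp)) 2
      have := ih fun x hx => h x (by simp [hx])
      push_cast
      linarith [norm_add_le (a ^ 2) (s.map (· ^ 2)).sum]
  simpa [hcard, hn] using h4 p.roots hB

/-- A sequence whose binomial polynomials have uniformly bounded roots satisfies
`a 2 = a 1 ^ 2`. -/
theorem eq_sq_of_binomial_ne_zero {a : ℕ → ℂ} (ha : a 0 = 1) {B : ℝ}
    (h : ∀ (n : ℕ) (x : ℂ), B < ‖x‖ →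
      ∑ k ∈ Finset.range (n + 1), (n.choose k : ℂ) * x ^ (n - k) * a k ≠ 0) :
    a 2 = a 1 ^ 2 := by
  have key : ∀ n : ℕ, ‖((n : ℂ) + 2) * a 1 ^ 2 - (n + 1) * a 2‖ ≤ B ^ 2 := by
    intro n
    set p : Polynomial ℂ := ∑ k ∈ Finset.range (n + 2 + 1),
      Polynomial.C (((n + 2).choose k : ℂ) * a k) * Polynomial.X ^ (n + 2 - k) with hp
    have hcoeff : ∀ j ≤ n + 2, p.coeff (n + 2 - j) = ((n + 2).choose j : ℂ) * a j := by
      intro j hj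
      rw [hp, Polynomial.finsetSum_coeff, Finset.sum_eq_single j]
      · rw [Polynomial.coeff_C_mul_X_pow, if_pos rfl]
      · intro k hk hkj
        rw [Polynomial.coeff_C_mul_X_pow, if_neg]
        simp at hk
        omega
      · intro hj'
        simp at hj'
        omega
    have hdeg : p.natDegree ≤ n + 2 := by
      refine Polynomial.natDegree_sum_le_of_forall_le _ _ fun k _ => ?_
      exact (Polynomial.natDegree_C_mul_X_pow_le _ _).trans (by omega)
    have hlead : p.coeff (n + 2) = 1 := by simpa [ha] using hcoeff 0 (by omega)
    have hmonic : p.Monic := Polynomial.monic_of_natDegree_le_of_coeff_eq_one _ hdeg hlead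
    have hnat : p.natDegree = n + 2 :=
      le_antisymm hdeg (Polynomial.le_natDegree_of_ne_zero (by rw [hlead]; simp))
    have := hmonic.norm_coeff_sq_sub_le hnat (B := B) (by
      intro x hx
      by_contra! hlt
      apply h (n + 2) x hlt
      have := (Polynomial.mem_roots'.mp hx).2
      simp only [Polynomial.IsRoot, hp, Polynomial.eval_finsetSum, Polynomial.eval_mul,
        Polynomial.eval_C, Polynomial.eval_pow, Polynomial.eval_X] at this
      rw [← this]
      exact Finset.sum_congr rfl fun k _ => by ring)
    have e1 := hcoeff 1 (by omega)
    have e2 := hcoeff 2 (by omega)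
    rw [show n + 2 - 1 = n + 1 by omega] at e1
    rw [show n + 2 - 2 = n by omega] at e2
    rw [e1, e2] at this
    have hc2 : (((n + 2).choose 2 : ℕ) : ℂ) = (n + 2) * (n + 1) / 2 := by
      rw [Nat.cast_choose_two]; push_cast; ring
    rw [hc2] at this
    have e3 : (((n + 2).choose 1 : ℕ) * a 1) ^ 2 - 2 * (((n : ℂ) + 2) * (n + 1) / 2 * a 2)
        = ((n : ℂ) + 2) * ((n + 2) * a 1 ^ 2 - (n + 1) * a 2) := by
      simp; ring
    rw [e3, norm_mul] at this
    have e4 : ‖(n : ℂ) + 2‖ = n + 2 := by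
      have : ((n : ℂ) + 2) = ((n + 2 : ℕ) : ℂ) := by push_cast; ring
      rw [this, Complex.norm_natCast]; push_cast; ring
    rw [e4] at this
    exact le_of_mul_le_mul_left this (by positivity)
  by_contra hne
  have hpos : 0 < ‖a 1 ^ 2 - a 2‖ := norm_pos_iff.mpr fun h0 => hne (sub_eq_zero.mp h0).symm
  obtain ⟨n, hn⟩ := exists_nat_gt ((B ^ 2 + ‖a 1 ^ 2‖) / ‖a 1 ^ 2 - a 2‖)
  rw [div_lt_iff₀ hpos] at hn
  have h1 := key n
  have h2 : ((n : ℂ) + 2) * a 1 ^ 2 - (n + 1) * a 2 = (n + 1) * (a 1 ^ 2 - a 2) + a 1 ^ 2 := by ring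
  rw [h2] at h1
  have h3 := norm_sub_le (((n : ℂ) + 1) * (a 1 ^ 2 - a 2) + a 1 ^ 2) (a 1 ^ 2)
  rw [add_sub_cancel_right, norm_mul] at h3
  have e4 : ‖(n : ℂ) + 1‖ = n + 1 := by
    have : ((n : ℂ) + 1) = ((n + 1 : ℕ) : ℂ) := by push_cast; ring
    rw [this, Complex.norm_natCast]; push_cast; ring
  rw [e4] at h3
  nlinarith

namespace FiniteEnergy

variable {ω : ℂ → ℝ} {f g F : ℂ → ℂ}

theorem differentiableAt (hf : FiniteEnergy ω f) {z : ℂ} (hz : z ∈ unitDisk) :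
    DifferentiableAt ℂ f z :=
  hf.1.differentiableAt (isOpen_unitDisk.mem_nhds hz)

theorem of_norm_deriv_sq_le (hω : IsIntegrableWeight ω) (hf : FiniteEnergy ω f)
    (hg : FiniteEnergy ω g) (hF : DifferentiableOn ℂ F unitDisk) (C : ℝ)
    (h : ∀ z ∈ unitDisk, ‖deriv F z‖ ^ 2 ≤ C * (‖deriv f z‖ ^ 2 + ‖deriv g z‖ ^ 2 + 1)) :
    FiniteEnergy ω F := by
  refine ⟨hF, ?_⟩
  have hm : ∀ f : ℂ → ℂ, AEMeasurable (fun z => ENNReal.ofReal (‖deriv f z‖ ^ 2 * ω z))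
      (volume.restrict unitDisk) := fun f =>
    (((measurable_deriv f).norm.pow_const 2).aemeasurable.mul hω.aemeasurable).ennreal_ofReal
  have hle : (∫⁻ z in unitDisk, ENNReal.ofReal (‖deriv F z‖ ^ 2 * ω z)) ≤
      ∫⁻ z in unitDisk, ENNReal.ofReal |C| * (ENNReal.ofReal (‖deriv f z‖ ^ 2 * ω z) +
        ENNReal.ofReal (‖deriv g z‖ ^ 2 * ω z) + ENNReal.ofReal (ω z)) := by
    refine setLIntegral_mono' measurableSet_unitDisk fun z hz => ?_
    have hp := hω.pos z hz
    rw [← ENNReal.ofReal_add (by positivity) (by positivity),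
      ← ENNReal.ofReal_add (by positivity) (by positivity), ← ENNReal.ofReal_mul (abs_nonneg _)]
    refine ENNReal.ofReal_le_ofReal ?_
    calc ‖deriv F z‖ ^ 2 * ω z
        ≤ |C| * (‖deriv f z‖ ^ 2 + ‖deriv g z‖ ^ 2 + 1) * ω z :=
          mul_le_mul_of_nonneg_right ((h z hz).trans
            (mul_le_mul_of_nonneg_right (le_abs_self C) (by positivity))) hp.le
      _ = _ := by ring
  refine hle.trans_lt ?_
  rw [lintegral_const_mul' _ _ ENNReal.ofReal_ne_top,
    lintegral_add_right' _ hω.aemeasurable.ennreal_ofReal, lintegral_add_left' (hm f)]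
  exact ENNReal.mul_lt_top ENNReal.ofReal_lt_top
    (ENNReal.add_lt_top.mpr ⟨ENNReal.add_lt_top.mpr ⟨hf.2, hg.2⟩, hω.lintegral_lt_top⟩)

theorem const (c : ℂ) : FiniteEnergy ω fun _ => c :=
  ⟨differentiableOn_const c, by simp⟩

theorem id (hω : IsIntegrableWeight ω) : FiniteEnergy ω fun z => z :=
  of_norm_deriv_sq_le hω (const 0) (const 0) differentiableOn_id 1 (by simp)

theorem add (hω : IsIntegrableWeight ω) (hf : FiniteEnergy ω f) (hg : FiniteEnergy ω g) :
    FiniteEnergy ω fun z => f z + g z := by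
  refine of_norm_deriv_sq_le hω hf hg (hf.1.add hg.1) 2 fun z hz => ?_
  rw [deriv_fun_add (hf.differentiableAt hz) (hg.differentiableAt hz)]
  have h1 := norm_add_le (deriv f z) (deriv g z)
  have h2 := pow_le_pow_left₀ (norm_nonneg _) h1 2
  nlinarith [sq_nonneg (‖deriv f z‖ - ‖deriv g z‖)]

theorem const_mul (hω : IsIntegrableWeight ω) (hf : FiniteEnergy ω f) (c : ℂ) :
    FiniteEnergy ω fun z => c * f z := by
  refine of_norm_deriv_sq_le hω hf (const 0) (hf.1.const_mul c) (‖c‖ ^ 2) fun z hz => ?_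
  rw [deriv_const_mul c (hf.differentiableAt hz), norm_mul, mul_pow]
  simp
  nlinarith [sq_nonneg ‖c‖]

theorem mul (hω : IsIntegrableWeight ω) (hf : FiniteEnergy ω f) (hg : FiniteEnergy ω g)
    {B : ℝ} (hfB : ∀ z ∈ unitDisk, ‖f z‖ ≤ B) (hgB : ∀ z ∈ unitDisk, ‖g z‖ ≤ B) :
    FiniteEnergy ω fun z => f z * g z := by
  refine of_norm_deriv_sq_le hω hf hg (hf.1.mul hg.1) (2 * B ^ 2) fun z hz => ?_
  rw [deriv_fun_mul (hf.differentiableAt hz) (hg.differentiableAt hz)]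
  have hf' := hfB z hz
  have hg' := hgB z hz
  have hB : 0 ≤ B := (norm_nonneg _).trans hf'
  have h1 : ‖deriv f z * g z + f z * deriv g z‖ ≤ ‖deriv f z‖ * B + B * ‖deriv g z‖ := by
    refine (norm_add_le _ _).trans ?_
    rw [norm_mul, norm_mul]
    gcongr
  have h2 := pow_le_pow_left₀ (norm_nonneg _) h1 2
  nlinarith [sq_nonneg (B * (‖deriv f z‖ - ‖deriv g z‖)), sq_nonneg B]

theorem pow (hω : IsIntegrableWeight ω) (hf : FiniteEnergy ω f) {B : ℝ}
    (hfB : ∀ z ∈ unitDisk, ‖f z‖ ≤ B) (k : ℕ) : FiniteEnergy ω fun z => f z ^ k := by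
  induction k with
  | zero => simpa using const 1
  | succ k ih =>
    simp only [pow_succ]
    refine ih.mul hω hf (B := max (B ^ k) B) (fun z hz => ?_)
      fun z hz => (hfB z hz).trans (le_max_right _ _)
    rw [norm_pow]
    exact (pow_le_pow_left₀ (norm_nonneg _) (hfB z hz) k).trans (le_max_left _ _)

theorem inv (hω : IsIntegrableWeight ω) (hf : FiniteEnergy ω f) {δ : ℝ} (hδ : 0 < δ)
    (hfδ : ∀ z ∈ unitDisk, δ ≤ ‖f z‖) : FiniteEnergy ω fun z => (f z)⁻¹ := by
  have hne : ∀ z ∈ unitDisk, f z ≠ 0 := fun z hz h0 => by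
    have := hfδ z hz
    rw [h0, norm_zero] at this
    linarith
  refine of_norm_deriv_sq_le hω hf (const 0) (hf.1.inv hne) ((δ ^ 4)⁻¹) fun z hz => ?_
  rw [deriv_fun_inv'' (hf.differentiableAt hz) (hne z hz), norm_div, norm_neg, norm_pow, div_pow,
    ← pow_mul]
  have h1 : (‖f z‖ ^ (2 * 2))⁻¹ ≤ (δ ^ 4)⁻¹ :=
    inv_anti₀ (by positivity) (pow_le_pow_left₀ hδ.le (hfδ z hz) 4)
  rw [div_eq_mul_inv, mul_comm]
  refine mul_le_mul h1 ?_ (by positivity) (by positivity)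
  simp

/-- The difference quotient of a bounded function of finite energy is bounded and has
finite energy. -/
theorem dslope (hω : IsIntegrableWeight ω) (hf : FiniteEnergy ω f) {B : ℝ}
    (hfB : ∀ z ∈ unitDisk, ‖f z‖ ≤ B) {w : ℂ} (hw : w ∈ unitDisk) :
    FiniteEnergy ω (dslope f w) ∧ ∃ M, ∀ z ∈ unitDisk, ‖dslope f w z‖ ≤ M := by
  have hd : DifferentiableOn ℂ (_root_.dslope f w) unitDisk :=
    (Complex.differentiableOn_dslope (isOpen_unitDisk.mem_nhds hw)).mpr hf.1
  obtain ⟨ρ, hρ, hρw⟩ := Metric.nhds_basis_closedBall.mem_iff.mp (isOpen_unitDisk.mem_nhds hw)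
  obtain ⟨M₁, hM₁⟩ := (isCompact_closedBall w ρ).exists_bound_of_continuousOn
    (hd.continuousOn.mono hρw)
  obtain ⟨M₂, hM₂⟩ := (isCompact_closedBall w ρ).exists_bound_of_continuousOn
    ((hd.deriv isOpen_unitDisk).continuousOn.mono hρw)
  have hbd : ∀ z ∈ unitDisk, ‖_root_.dslope f w z‖ ≤ max M₁ (2 * B / ρ) := by
    intro z hz
    by_cases hzw : z ∈ Metric.closedBall w ρ
    · exact (hM₁ z hzw).trans (le_max_left _ _)
    · refine le_trans ?_ (le_max_right _ _)
      rw [Metric.mem_closedBall, not_le, dist_eq_norm] at hzw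
      have hne : z ≠ w := fun h => by simp [h] at hzw; linarith
      rw [dslope_of_ne _ hne, slope_def_field, norm_div]
      have := (norm_sub_le (f z) (f w)).trans (add_le_add (hfB z hz) (hfB w hw))
      exact div_le_div₀ (by linarith [norm_nonneg (f z - f w)]) (by linarith) hρ hzw.le
  set M := max M₁ (2 * B / ρ)
  refine ⟨of_norm_deriv_sq_le hω hf (const 0) hd
    (M₂ ^ 2 + 2 / ρ ^ 2 + 2 * M ^ 2 / ρ ^ 2) fun z hz => ?_, M, hbd⟩
  simp only [deriv_const, norm_zero]
  by_cases hzw : z ∈ Metric.closedBall w ρ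
  · have h1 := pow_le_pow_left₀ (norm_nonneg _) (hM₂ z hzw) 2
    have h2 : 0 ≤ 2 / ρ ^ 2 + 2 * M ^ 2 / ρ ^ 2 := by positivity
    nlinarith [mul_nonneg h2 (sq_nonneg ‖deriv f z‖), mul_nonneg (sq_nonneg M₂) (sq_nonneg ‖deriv f z‖)]
  · rw [Metric.mem_closedBall, not_le, dist_eq_norm] at hzw
    have hne : z ≠ w := fun h => by simp [h] at hzw; linarith
    have hsub : z - w ≠ 0 := sub_ne_zero.mpr hne
    have hdz := hd.differentiableAt (isOpen_unitDisk.mem_nhds hz)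
    have hmul : deriv f z = _root_.dslope f w z + (z - w) * deriv (_root_.dslope f w) z := by
      have he : f = fun z => f w + (z - w) * _root_.dslope f w z := by
        funext z
        have := sub_smul_dslope f w z
        rw [smul_eq_mul] at this
        rw [this]; ring
      have hD : HasDerivAt (fun z => f w + (z - w) * _root_.dslope f w z)
          (1 * _root_.dslope f w z + (z - w) * deriv (_root_.dslope f w) z) z :=
        (((hasDerivAt_id z).sub_const w).mul hdz.hasDerivAt).const_add (f w)
      conv_lhs => rw [he]
      rw [hD.deriv, one_mul]
    have h3 : ‖z - w‖ * ‖deriv (_root_.dslope f w) z‖ ≤ ‖deriv f z‖ + M := by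
      rw [← norm_mul, show (z - w) * deriv (_root_.dslope f w) z =
        deriv f z - _root_.dslope f w z by rw [hmul]; ring]
      exact (norm_sub_le _ _).trans (by linarith [hbd z hz])
    have h4 : ρ * ‖deriv (_root_.dslope f w) z‖ ≤ ‖deriv f z‖ + M :=
      (mul_le_mul_of_nonneg_right hzw.le (norm_nonneg _)).trans h3
    have h5 := pow_le_pow_left₀ (by positivity) h4 2
    have h6 : ‖deriv (_root_.dslope f w) z‖ ^ 2 ≤ (2 * ‖deriv f z‖ ^ 2 + 2 * M ^ 2) / ρ ^ 2 := by
      rw [le_div_iff₀ (by positivity)]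
      nlinarith [sq_nonneg (‖deriv f z‖ - M)]
    refine h6.trans ?_
    have h7 : 0 ≤ M₂ ^ 2 * (‖deriv f z‖ ^ 2 + 1) + 2 / ρ ^ 2
        + 2 * M ^ 2 / ρ ^ 2 * ‖deriv f z‖ ^ 2 := by positivity
    have h8 : (2 * ‖deriv f z‖ ^ 2 + 2 * M ^ 2) / ρ ^ 2 =
      2 / ρ ^ 2 * ‖deriv f z‖ ^ 2 + 2 * M ^ 2 / ρ ^ 2 := by ring
    rw [h8]
    nlinarith

end FiniteEnergy

/-- `L` is a linear functional on functions of finite energy, normalised at `1` and non-zero on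
zero-free functions. -/
structure IsNonvanishingFunctional (ω : ℂ → ℝ) (L : (ℂ → ℂ) → ℂ) : Prop where
  congr : ∀ f g : ℂ → ℂ, Set.EqOn f g unitDisk → L f = L g
  add : ∀ f g : ℂ → ℂ, FiniteEnergy ω f → FiniteEnergy ω g →
    L (fun z => f z + g z) = L f + L g
  const_mul : ∀ (c : ℂ) (f : ℂ → ℂ), FiniteEnergy ω f → L (fun z => c * f z) = c * L f
  one : L (fun _ => 1) = 1
  ne_zero : ∀ f : ℂ → ℂ, FiniteEnergy ω f → (∀ z ∈ unitDisk, f z ≠ 0) → L f ≠ 0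

namespace IsNonvanishingFunctional

variable {ω : ℂ → ℝ} {L : (ℂ → ℂ) → ℂ}

theorem const (hL : IsNonvanishingFunctional ω L) (c : ℂ) : L (fun _ => c) = c := by
  simpa [hL.one] using hL.const_mul c (fun _ => 1) (.const 1)

theorem sum (hL : IsNonvanishingFunctional ω L) (hω : IsIntegrableWeight ω) (c : ℕ → ℂ)
    (F : ℕ → ℂ → ℂ) (hF : ∀ k, FiniteEnergy ω (F k)) (n : ℕ) :
    FiniteEnergy ω (fun z => ∑ k ∈ Finset.range n, c k * F k z) ∧
      L (fun z => ∑ k ∈ Finset.range n, c k * F k z) = ∑ k ∈ Finset.range n, c k * L (F k) := by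
  induction n with
  | zero => simpa using ⟨FiniteEnergy.const 0, hL.const 0⟩
  | succ n ih =>
    simp only [Finset.sum_range_succ]
    have h := (hF n).const_mul hω (c n)
    exact ⟨ih.1.add hω h, by rw [hL.add _ _ ih.1 h, ih.2, hL.const_mul _ _ (hF n)]⟩

theorem sq_mul (hL : IsNonvanishingFunctional ω L) (hω : IsIntegrableWeight ω) {b s : ℂ → ℂ}
    {B : ℝ} (hb : ∀ z ∈ unitDisk, ‖b z‖ ≤ B) (hs : ∀ z ∈ unitDisk, s z ≠ 0)
    (hF : ∀ k : ℕ, FiniteEnergy ω fun z => b z ^ k * s z) :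
    L (fun z => b z ^ 2 * s z) * L s = L (fun z => b z * s z) ^ 2 := by
  have hs0 : FiniteEnergy ω s := by simpa using hF 0
  have hLs : L s ≠ 0 := hL.ne_zero s hs0 hs
  have key := eq_sq_of_binomial_ne_zero (a := fun k => L (fun z => b z ^ k * s z) / L s) (B := B)
    (by simp [hLs]) (by
      intro n x hx
      have h := hL.sum hω (fun k => (n.choose k : ℂ) * x ^ (n - k)) _ hF (n + 1)
      have hne := hL.ne_zero _ h.1 (by
        intro z hz
        have e : ∑ k ∈ Finset.range (n + 1), (n.choose k : ℂ) * x ^ (n - k) * (b z ^ k * s z)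
            = (b z + x) ^ n * s z := by
          rw [add_pow, Finset.sum_mul]
          exact Finset.sum_congr rfl fun k _ => by ring
        rw [e]
        refine mul_ne_zero (pow_ne_zero _ fun h0 => ?_) (hs z hz)
        have := hb z hz
        rw [eq_neg_of_add_eq_zero_left h0, norm_neg] at this
        linarith)
      rw [h.2] at hne
      simp only [← mul_div_assoc, ← Finset.sum_div]
      exact div_ne_zero hne hLs)
  simp only [pow_one] at key
  field_simp at key
  linear_combination key

theorem mul (hL : IsNonvanishingFunctional ω L) (hω : IsIntegrableWeight ω) {b c : ℂ → ℂ}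
    {B : ℝ} (hb : ∀ z ∈ unitDisk, ‖b z‖ ≤ B) (hc : ∀ z ∈ unitDisk, ‖c z‖ ≤ B)
    (hbF : FiniteEnergy ω b) (hcF : FiniteEnergy ω c) :
    L (fun z => b z * c z) = L b * L c := by
  have hsq : ∀ f : ℂ → ℂ, ∀ B : ℝ, FiniteEnergy ω f → (∀ z ∈ unitDisk, ‖f z‖ ≤ B) →
      L (fun z => f z ^ 2) = L f ^ 2 := by
    intro f B hf hfB
    simpa [hL.one] using hL.sq_mul hω (s := fun _ => 1) hfB (by simp)
      (fun k => by simpa using hf.pow hω hfB k)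
  have h1 := hsq (fun z => b z + c z) (B + B) (hbF.add hω hcF)
    fun z hz => (norm_add_le _ _).trans (add_le_add (hb z hz) (hc z hz))
  have hb2 := hbF.pow hω hb 2
  have hc2 := hcF.pow hω hc 2
  have hbc := hbF.mul hω hcF hb hc
  have h2 : L (fun z => (b z + c z) ^ 2) =
      L (fun z => b z ^ 2) + (2 * L (fun z => b z * c z) + L (fun z => c z ^ 2)) := by
    rw [← hL.const_mul _ _ hbc, ← hL.add _ _ (hbc.const_mul hω 2) hc2,
      ← hL.add _ _ hb2 ((hbc.const_mul hω 2).add hω hc2)]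
    exact hL.congr _ _ fun z _ => by ring
  rw [h1, hL.add _ _ hbF hcF, hsq b B hbF hb, hsq c B hcF hc] at h2
  linear_combination -h2 / 2

theorem inv_mul (hL : IsNonvanishingFunctional ω L) (hω : IsIntegrableWeight ω) {s : ℂ → ℂ}
    (hs : FiniteEnergy ω s) {δ : ℝ} (hδ : 0 < δ) (hsδ : ∀ z ∈ unitDisk, δ ≤ ‖s z‖) :
    L (fun z => (s z)⁻¹) * L s = 1 := by
  have hne : ∀ z ∈ unitDisk, s z ≠ 0 := fun z hz h0 => by
    have := hsδ z hz
    rw [h0, norm_zero] at this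
    linarith
  have hb : ∀ z ∈ unitDisk, ‖(s z)⁻¹‖ ≤ δ⁻¹ := fun z hz => by
    rw [norm_inv]
    exact inv_anti₀ hδ (hsδ z hz)
  have hcongr : ∀ {f g : ℂ → ℂ}, FiniteEnergy ω f → Set.EqOn g f unitDisk →
      FiniteEnergy ω g := fun {f g} hf hfg =>
    .of_norm_deriv_sq_le hω hf (.const 0) (hf.1.congr hfg) 1 fun z hz => by
      rw [Filter.EventuallyEq.deriv_eq (hfg.eventuallyEq_of_mem (isOpen_unitDisk.mem_nhds hz))]
      simp
  have h := hL.sq_mul hω hb hne (fun k => by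
    cases k with
    | zero => simpa using hs
    | succ k =>
      refine hcongr ((hs.inv hω hδ hsδ).pow hω hb k) fun z hz => ?_
      have := hne z hz
      simp only [pow_succ]
      field_simp)
  rw [hL.congr (fun z => (s z)⁻¹ ^ 2 * s z) (fun z => (s z)⁻¹) fun z hz => by
      have := hne z hz
      field_simp,
    hL.congr (fun z => (s z)⁻¹ * s z) (fun z => 1) fun z hz => inv_mul_cancel₀ (hne z hz),
    hL.one, one_pow] at h
  exact h

theorem apply_id_mem (hL : IsNonvanishingFunctional ω L) (hω : IsIntegrableWeight ω) :
    L (fun z => z) ∈ unitDisk := by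
  set w := L fun z => z
  by_contra hw
  refine hL.ne_zero (fun z => z + -w) ((FiniteEnergy.id hω).add hω (.const _)) ?_ ?_
  · intro z hz h0
    exact hw (add_neg_eq_zero.mp h0 ▸ hz)
  · rw [hL.add _ _ (.id hω) (.const _), hL.const]
    exact add_neg_cancel w

theorem eq_of_bounded (hL : IsNonvanishingFunctional ω L) (hω : IsIntegrableWeight ω)
    {f : ℂ → ℂ} (hf : FiniteEnergy ω f) {B : ℝ} (hfB : ∀ z ∈ unitDisk, ‖f z‖ ≤ B) :
    L f = f (L fun z => z) := by
  have hw := hL.apply_id_mem hω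
  set w := L fun z => z with hw_def
  obtain ⟨hd, M, hM⟩ := hf.dslope hω hfB hw
  have hz : FiniteEnergy ω fun z => z + -w := (FiniteEnergy.id hω).add hω (.const _)
  have hzB : ∀ z ∈ unitDisk, ‖z + -w‖ ≤ 2 := fun z hz => by
    rw [mem_unitDisk] at hz hw
    exact (norm_add_le _ _).trans (by rw [norm_neg]; linarith)
  have hzB' := fun z hz => (hzB z hz).trans (le_max_left 2 M)
  have hM' := fun z hz => (hM z hz).trans (le_max_right 2 M)
  have hmul := hL.mul hω hzB' hM' hz hd
  rw [hL.add _ _ (.id hω) (.const _), hL.const, ← hw_def, add_neg_cancel, zero_mul] at hmul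
  have hsum := hL.add (fun _ => f w) _ (.const _) (hz.mul hω hd hzB' hM')
  rw [hmul, hL.const, add_zero] at hsum
  rw [← hsum]
  refine hL.congr _ _ fun z _ => ?_
  have := sub_smul_dslope f w z
  rw [smul_eq_mul] at this
  simp only [← sub_eq_add_neg, this]
  ring

theorem eq_of_le_norm (hL : IsNonvanishingFunctional ω L) (hω : IsIntegrableWeight ω)
    {s : ℂ → ℂ} (hs : FiniteEnergy ω s) {δ : ℝ} (hδ : 0 < δ)
    (hsδ : ∀ z ∈ unitDisk, δ ≤ ‖s z‖) : L s = s (L fun z => z) := by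
  have h1 := hL.inv_mul hω hs hδ hsδ
  rw [hL.eq_of_bounded hω (hs.inv hω hδ hsδ) (B := δ⁻¹) fun z hz => by
    rw [norm_inv]; exact inv_anti₀ hδ (hsδ z hz)] at h1
  have h2 := hsδ _ (hL.apply_id_mem hω)
  have h3 : s (L fun z => z) ≠ 0 := fun h0 => by
    rw [h0, norm_zero] at h2
    linarith
  field_simp at h1
  exact h1

/-- A functional that is non-zero on zero-free functions is a point evaluation as soon as every
function of finite energy is dominated by the real part of another one. -/
theorem eq_apply (hL : IsNonvanishingFunctional ω L) (hω : IsIntegrableWeight ω)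
    {f g : ℂ → ℂ} (hf : FiniteEnergy ω f) (hg : FiniteEnergy ω g)
    (hfg : ∀ z ∈ unitDisk, ‖f z‖ ≤ (g z).re) : L f = f (L fun z => z) := by
  have hg1 : FiniteEnergy ω fun z => g z + 1 := hg.add hω (.const 1)
  have h1 := hL.eq_of_le_norm hω hg1 one_pos fun z hz => by
    refine le_trans ?_ (Complex.re_le_norm _)
    simpa using (norm_nonneg _).trans (hfg z hz)
  have h2 := hL.eq_of_le_norm hω (hf.add hω hg1) one_pos fun z hz => by
    refine le_trans ?_ (Complex.re_le_norm _)
    have h3 := hfg z hz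
    have h4 := neg_le_of_abs_le (Complex.abs_re_le_norm (f z))
    simp only [Complex.add_re, Complex.one_re]
    linarith
  rw [hL.add _ _ hf hg1, h1] at h2
  exact add_right_cancel h2

end IsNonvanishingFunctional

/-! ### Circle means -/

theorem setIntegral_re_circleMap {N : ℂ → ℂ} {U : Set ℂ} (hN : DifferentiableOn ℂ N U) {z : ℂ}
    {r : ℝ} (hr : 0 < r) (hU : Metric.closedBall z r ⊆ U) :
    IntegrableOn (fun θ => (N (circleMap z r θ)).re) (Set.Ioc 0 (2 * Real.pi)) ∧
      ∫ θ in Set.Ioc 0 (2 * Real.pi), (N (circleMap z r θ)).re = 2 * Real.pi * (N z).re := by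
  have hcont : Continuous fun θ => N (circleMap z r θ) :=
    (hN.continuousOn.mono hU).comp_continuous (continuous_circleMap z r)
      fun θ => circleMap_mem_closedBall z hr.le θ
  have hint : IntervalIntegrable (fun θ => N (circleMap z r θ)) volume 0 (2 * Real.pi) :=
    hcont.intervalIntegrable _ _
  have havg : Real.circleAverage N z r = N z := by
    refine DiffContOnCl.circleAverage ?_
    rw [abs_of_pos hr]
    refine DifferentiableOn.diffContOnCl (hN.mono ?_)
    rwa [closure_ball z hr.ne']
  rw [Real.circleAverage_def, inv_smul_eq_iff₀ (by positivity)] at havg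
  have hint' := (intervalIntegrable_iff_integrableOn_Ioc_of_le Real.two_pi_pos.le).mp hint
  refine ⟨hint'.re, ?_⟩
  rw [intervalIntegral.integral_of_le Real.two_pi_pos.le] at havg
  have h := integral_re hint'
  simp only [RCLike.re_to_complex] at h
  rw [h, havg]
  simp

theorem ofReal_le_lintegral_circleMap {N : ℂ → ℂ} {U : Set ℂ} (hN : DifferentiableOn ℂ N U)
    {z : ℂ} {r : ℝ} (hr : 0 < r) (hU : Metric.closedBall z r ⊆ U) (hNz : N z = 0) {A B : ℝ}
    {q : ℂ → ℝ} (hB : 0 ≤ B) (hq : ∀ w ∈ Metric.sphere z r, A + (N w).re ≤ q w + B) :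
    ENNReal.ofReal (2 * Real.pi * A) ≤
      (∫⁻ θ in Set.Ioc 0 (2 * Real.pi), ENNReal.ofReal (q (circleMap z r θ))) +
        ENNReal.ofReal (2 * Real.pi * B) := by
  obtain ⟨hi, he⟩ := setIntegral_re_circleMap hN hr hU
  have hvol : volume (Set.Ioc 0 (2 * Real.pi)) = ENNReal.ofReal (2 * Real.pi) := by simp
  have hconst : ∫ θ in Set.Ioc 0 (2 * Real.pi), (A + (N (circleMap z r θ)).re) =
      2 * Real.pi * A := by
    rw [integral_add (by simp) hi, he, hNz]
    simp [Real.pi_pos.le]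
  have hcB : ENNReal.ofReal (2 * Real.pi * B) =
      ∫⁻ _ in Set.Ioc 0 (2 * Real.pi), ENNReal.ofReal B := by
    rw [setLIntegral_const, hvol, ← ENNReal.ofReal_mul hB, mul_comm B]
  rw [← hconst, hcB, ← lintegral_add_right _ measurable_const]
  have hint : IntegrableOn (fun θ => A + (N (circleMap z r θ)).re) (Set.Ioc 0 (2 * Real.pi)) :=
    Integrable.add (by simp) hi
  have hle : ENNReal.ofReal (∫ θ in Set.Ioc 0 (2 * Real.pi), (A + (N (circleMap z r θ)).re)) ≤
      ∫⁻ θ in Set.Ioc 0 (2 * Real.pi), ENNReal.ofReal (A + (N (circleMap z r θ)).re) := by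
    rw [integral_eq_lintegral_pos_part_sub_lintegral_neg_part hint]
    refine (ENNReal.ofReal_le_ofReal (sub_le_self _ ENNReal.toReal_nonneg)).trans ?_
    exact ENNReal.ofReal_toReal_le
  refine hle.trans (lintegral_mono fun θ => ?_)
  exact (ENNReal.ofReal_le_ofReal (hq _ (circleMap_mem_sphere z hr.le θ))).trans
    ENNReal.ofReal_add_le

theorem Complex.sq_norm_add (a b : ℂ) :
    ‖a + b‖ ^ 2 = ‖a‖ ^ 2 + ‖b‖ ^ 2 + 2 * (starRingEnd ℂ a * b).re := by
  simp only [Complex.sq_norm, Complex.normSq_apply, Complex.add_re, Complex.add_im,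
    Complex.mul_re, Complex.conj_re, Complex.conj_im]
  ring

/-- On a circle, `‖h‖ ^ 2` exceeds `‖h z‖ ^ 2 + r ^ 2 * ‖h' z‖ ^ 2` up to the real part of a
holomorphic function vanishing at the centre. -/
theorem exists_le_sq_norm_on_sphere {h : ℂ → ℂ} {U : Set ℂ} (hU : IsOpen U)
    (hh : DifferentiableOn ℂ h U) {z : ℂ} (hz : z ∈ U) (r : ℝ) :
    ∃ N : ℂ → ℂ, DifferentiableOn ℂ N U ∧ N z = 0 ∧ ∀ w ∈ Metric.sphere z r,
      ‖h z‖ ^ 2 + r ^ 2 * ‖deriv h z‖ ^ 2 + (N w).re ≤ ‖h w‖ ^ 2 := by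
  set a := deriv h z with ha
  set m := dslope (dslope h z) z with hm
  have hmd : DifferentiableOn ℂ m U :=
    (Complex.differentiableOn_dslope (hU.mem_nhds hz)).mpr
      ((Complex.differentiableOn_dslope (hU.mem_nhds hz)).mpr hh)
  have hexp : ∀ w, h w = h z + a * (w - z) + (w - z) ^ 2 * m w := by
    intro w
    have h1 := sub_smul_dslope h z w
    have h2 := sub_smul_dslope (dslope h z) z w
    rw [dslope_same] at h2
    simp only [smul_eq_mul] at h1 h2
    linear_combination (-1) * h1 - (w - z) * h2
  refine ⟨fun w => 2 * (starRingEnd ℂ (h z) * (a * (w - z))) +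
    2 * ((starRingEnd ℂ (h z) * (w - z) ^ 2 + starRingEnd ℂ a * r ^ 2 * (w - z)) * m w),
    ?_, by simp, fun w hw => ?_⟩
  · fun_prop
  · have hwz : ‖w - z‖ = r := by simpa [dist_eq_norm] using hw
    have hconj : starRingEnd ℂ (w - z) * (w - z) = r ^ 2 := by
      rw [mul_comm, Complex.mul_conj, Complex.normSq_eq_norm_sq, hwz]
      push_cast
      rfl
    have e1 := Complex.sq_norm_add (h z + a * (w - z)) ((w - z) ^ 2 * m w)
    have e2 := Complex.sq_norm_add (h z) (a * (w - z))
    rw [← hexp w] at e1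
    have e3 : starRingEnd ℂ (h z + a * (w - z)) * ((w - z) ^ 2 * m w) =
        (starRingEnd ℂ (h z) * (w - z) ^ 2 + starRingEnd ℂ a * r ^ 2 * (w - z)) * m w := by
      rw [map_add, map_mul, ← hconj]
      ring
    rw [e3] at e1
    have e4 : ‖a * (w - z)‖ ^ 2 = r ^ 2 * ‖a‖ ^ 2 := by rw [norm_mul, hwz]; ring
    have e5 : ∀ x y : ℂ, (2 * x + 2 * y).re = 2 * x.re + 2 * y.re := fun x y => by simp
    rw [e5]
    linarith [sq_nonneg ‖(w - z) ^ 2 * m w‖]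

theorem Function.Periodic.setLIntegral_Ioc_eq {f : ℝ → ENNReal} {T : ℝ}
    (hf : Function.Periodic f T) (hT : 0 < T) (a b : ℝ) :
    ∫⁻ x in Set.Ioc a (a + T), f x = ∫⁻ x in Set.Ioc b (b + T), f x := by
  refine (isAddFundamentalDomain_Ioc hT a volume).setLIntegral_eq
    (isAddFundamentalDomain_Ioc hT b volume) f ?_
  rintro ⟨g, hg⟩ x
  obtain ⟨n, rfl⟩ := AddSubgroup.mem_zmultiples_iff.mp hg
  rw [AddSubgroup.mk_vadd, vadd_eq_add, add_comm]
  exact hf.zsmul n x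

theorem lintegral_circleMap_neg_radius (h : ℂ → ENNReal) (z : ℂ) (r : ℝ) :
    ∫⁻ θ in Set.Ioc 0 (2 * Real.pi), h (circleMap z (-r) θ) =
      ∫⁻ θ in Set.Ioc 0 (2 * Real.pi), h (circleMap z r θ) := by
  have h1 : ∀ θ, circleMap z (-r) θ = circleMap z r (θ + Real.pi) := fun θ => by
    simp [circleMap, add_mul, Complex.exp_add]
  have h2 : Set.Ioc 0 (2 * Real.pi) =
      (fun x => x + Real.pi) ⁻¹' Set.Ioc Real.pi (Real.pi + 2 * Real.pi) := by
    ext x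
    simp only [Set.mem_Ioc, Set.mem_preimage]
    constructor <;> rintro ⟨ha, hb⟩ <;> constructor <;> linarith
  have hper : Function.Periodic (fun θ => h (circleMap z r θ)) (2 * Real.pi) :=
    (periodic_circleMap z r).comp h
  simp only [h1]
  have h3 := hper.setLIntegral_Ioc_eq Real.two_pi_pos Real.pi 0
  rw [zero_add] at h3
  rw [← h3]
  conv_lhs => rw [h2]
  exact (measurePreserving_add_right volume Real.pi).setLIntegral_comp_preimage_emb
    (MeasurableEquiv.addRight Real.pi).measurableEmbedding (fun θ => h (circleMap z r θ)) _

theorem lintegral_ball_eq_polar {h : ℂ → ENNReal} (hh : Measurable h) (R : ℝ) :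
    ∫⁻ z in Metric.ball 0 R, h z =
      ∫⁻ r in Set.Ioo 0 R, ENNReal.ofReal r *
        ∫⁻ θ in Set.Ioc 0 (2 * Real.pi), h (circleMap 0 r θ) := by
  have hcm : Measurable fun p : ℝ × ℝ => circleMap 0 p.1 p.2 := by
    unfold circleMap
    fun_prop
  have hsymm : ∀ p : ℝ × ℝ, Complex.polarCoord.symm p = circleMap 0 p.1 p.2 := by
    intro p
    rw [Complex.polarCoord_symm_apply, circleMap, Complex.exp_mul_I]
    simp
  have hball : MeasurableSet (Metric.ball (0 : ℂ) R) := Metric.isOpen_ball.measurableSet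
  rw [← lintegral_indicator hball, ← Complex.lintegral_comp_polarCoord_symm, polarCoord_target,
    Measure.volume_eq_prod, ← Measure.prod_restrict, lintegral_prod]
  · rw [← lintegral_indicator measurableSet_Ioi, ← lintegral_indicator measurableSet_Ioo]
    congr 1
    funext r
    by_cases hr : 0 < r
    · rw [Set.indicator_of_mem (by exact hr)]
      by_cases hrR : r < R
      · rw [Set.indicator_of_mem (by exact ⟨hr, hrR⟩)]
        simp only [hsymm, smul_eq_mul]
        rw [lintegral_const_mul]
        · congr 1
          rw [restrict_Ioo_eq_restrict_Ioc]
          have hper : Function.Periodic (fun θ => h (circleMap 0 r θ)) (2 * Real.pi) :=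
            (periodic_circleMap 0 r).comp h
          have hmem : ∀ θ, circleMap 0 r θ ∈ Metric.ball (0 : ℂ) R := fun θ => by
            simpa [abs_of_pos hr] using hrR
          simp only [Set.indicator_of_mem (hmem _)]
          have := hper.setLIntegral_Ioc_eq Real.two_pi_pos (-Real.pi) 0
          rw [zero_add, show -Real.pi + 2 * Real.pi = Real.pi by ring] at this
          exact this
        · exact (hh.indicator hball).comp (continuous_circleMap 0 r).measurable
      · rw [Set.indicator_of_notMem (by simp [hrR])]
        simp only [hsymm]
        have hmem : ∀ θ, circleMap 0 r θ ∉ Metric.ball (0 : ℂ) R := fun θ => by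
          simpa [abs_of_pos hr] using hrR
        simp [Set.indicator_of_notMem (hmem _)]
    · rw [Set.indicator_of_notMem (by simpa using hr), Set.indicator_of_notMem (by simp [hr])]
  · simp only [hsymm, smul_eq_mul]
    exact ((measurable_fst.ennreal_ofReal).mul ((hh.indicator hball).comp hcm)).aemeasurable

/-! ### Superharmonic weights -/

namespace SuperharmonicOn

variable {ω : ℂ → ℝ}

theorem measurable_indicator (hω : SuperharmonicOn ω) : Measurable (unitDisk.indicator ω) := by
  refine measurable_of_restrict_of_restrict_compl measurableSet_unitDisk ?_ ?_
  · have h : unitDisk.domRestrict (unitDisk.indicator ω) = unitDisk.domRestrict ω :=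
      funext fun z => Set.indicator_of_mem z.2 _
    rw [h]
    exact (lowerSemicontinuous_restrict_iff.mpr hω.1).measurable
  · have h : unitDiskᶜ.domRestrict (unitDisk.indicator ω) = fun _ => 0 :=
      funext fun z => Set.indicator_of_notMem z.2 _
    rw [h]
    exact measurable_const

theorem lintegral_circleMap_le (hω : SuperharmonicOn ω) {z : ℂ} {r : ℝ} (hr : 0 < r)
    (hz : Metric.closedBall z r ⊆ unitDisk) :
    ∫⁻ θ in Set.Ioc 0 (2 * Real.pi), ENNReal.ofReal (ω (circleMap z r θ)) ≤
      ENNReal.ofReal (2 * Real.pi * ω z) :=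
  hω.2 z r hr hz

theorem isIntegrableWeight (hω : SuperharmonicOn ω) (hpos : ∀ z ∈ unitDisk, 0 < ω z) :
    IsIntegrableWeight ω := by
  have hm := hω.measurable_indicator
  refine ⟨hpos, ⟨_, hm, ?_⟩, ?_⟩
  · filter_upwards [ae_restrict_mem measurableSet_unitDisk] with z hz
    rw [Set.indicator_of_mem hz]
  · have h1 : ∫⁻ z in unitDisk, ENNReal.ofReal (ω z) =
        ∫⁻ z in Metric.ball 0 1, ENNReal.ofReal (unitDisk.indicator ω z) :=
      setLIntegral_congr_fun measurableSet_unitDisk fun z hz => by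
        simp only [Set.indicator_of_mem hz]
    rw [h1, lintegral_ball_eq_polar hm.ennreal_ofReal]
    calc _ ≤ ∫⁻ r in Set.Ioo (0 : ℝ) 1, ENNReal.ofReal (2 * Real.pi * ω 0) := by
          refine setLIntegral_mono' measurableSet_Ioo fun r hr => ?_
          have hsub : Metric.closedBall (0 : ℂ) r ⊆ unitDisk :=
            Metric.closedBall_subset_ball hr.2
          have h2 : ∀ θ, unitDisk.indicator ω (circleMap 0 r θ) = ω (circleMap 0 r θ) :=
            fun θ => Set.indicator_of_mem (hsub (circleMap_mem_closedBall 0 hr.1.le θ)) _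
          simp only [h2]
          calc _ ≤ 1 * ENNReal.ofReal (2 * Real.pi * ω 0) :=
                mul_le_mul' (ENNReal.ofReal_le_one.mpr hr.2.le)
                  (hω.lintegral_circleMap_le hr.1 hsub)
            _ = _ := one_mul _
      _ < ⊤ := by simp

theorem exists_mul_one_sub_sq_le (hω : SuperharmonicOn ω) (hpos : ∀ z ∈ unitDisk, 0 < ω z) :
    ∃ c > 0, ∀ z ∈ unitDisk, c * (1 - ‖z‖ ^ 2) ≤ ω z := by
  have hsub : Metric.closedBall (0 : ℂ) (1 / 2) ⊆ unitDisk :=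
    Metric.closedBall_subset_ball (by norm_num)
  obtain ⟨p, hp, hmin⟩ := LowerSemicontinuousOn.exists_isMinOn (s := Metric.closedBall (0 : ℂ) (1 / 2))
    ⟨0, by simp⟩ (isCompact_closedBall _ _) (hω.1.mono hsub)
  have hmin' : ∀ z : ℂ, ‖z‖ ≤ 1 / 2 → ω p ≤ ω z := fun z hz =>
    hmin (by simpa using hz)
  set c := ω p / 3 with hc
  have hc0 : 0 < c := div_pos (hpos p (hsub hp)) (by norm_num)
  have hcp : ω p = 3 * c := by rw [hc]; ring
  refine ⟨c, hc0, fun z hz => ?_⟩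
  rcases le_or_gt ‖z‖ (1 / 2) with hz2 | hz2
  · have := hmin' z hz2
    nlinarith [sq_nonneg ‖z‖]
  suffices hφ : c * (‖z⁻¹‖ ^ 2 - 1) ≤ ω z by
    refine le_trans (mul_le_mul_of_nonneg_left ?_ hc0.le) hφ
    rw [norm_inv, inv_pow]
    have h0 : 0 < ‖z‖ ^ 2 := by positivity
    have : ‖z‖ ^ 2 * (‖z‖ ^ 2)⁻¹ = 1 := mul_inv_cancel₀ h0.ne'
    nlinarith [sq_nonneg (‖z‖ ^ 2 - 1), inv_pos.mpr h0]
  by_contra! hlt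
  set φ : ℂ → ℝ := fun w => c * (‖w⁻¹‖ ^ 2 - 1) with hφ
  have hzlt : ‖z‖ < 1 := mem_unitDisk.mp hz
  have hcont : ∀ᶠ R in nhdsWithin (1 : ℝ) (Set.Iio 1), c * (R⁻¹ ^ 2 - 1) < φ z - ω z := by
    have hca : ContinuousAt (fun R : ℝ => c * (R⁻¹ ^ 2 - 1)) 1 := by fun_prop (disch := norm_num)
    refine nhdsWithin_le_nhds (hca.eventually (gt_mem_nhds ?_))
    have : ω z < φ z := hlt
    simpa using this
  obtain ⟨R, hR, hR1, hzR⟩ : ∃ R, c * (R⁻¹ ^ 2 - 1) < φ z - ω z ∧ R < 1 ∧ ‖z‖ < R :=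
    (hcont.and ((eventually_mem_nhdsWithin).and
      (nhdsWithin_le_nhds (lt_mem_nhds hzlt)))).exists
  set K : Set ℂ := Metric.closedBall 0 R \ Metric.ball 0 (1 / 2) with hK
  have hKc : IsCompact K := (isCompact_closedBall _ _).diff Metric.isOpen_ball
  have hKsub : K ⊆ unitDisk := fun w hw => Metric.closedBall_subset_ball hR1 hw.1
  have hKne : ∀ w ∈ K, w ≠ 0 := fun w hw h0 => by
    have := hw.2
    simp [h0] at this
  have hφc : ContinuousOn φ K :=
    continuousOn_const.mul ((((continuousOn_inv₀).mono hKne).norm.pow 2).sub continuousOn_const)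
  have hlsc : LowerSemicontinuousOn (fun w => ω w + -φ w) K :=
    (hω.1.mono hKsub).add hφc.neg.lowerSemicontinuousOn
  have hzK : z ∈ K := ⟨by simpa using hzR.le, by simpa using hz2.le⟩
  obtain ⟨z₀, hz₀, hz₀min⟩ := hlsc.exists_isMinOn ⟨z, hzK⟩ hKc
  have hm : ω z₀ + -φ z₀ ≤ ω z + -φ z := hz₀min hzK
  have h1 : ‖z₀‖ ≤ R := by simpa using hz₀.1
  have h2 : 1 / 2 ≤ ‖z₀‖ := by simpa using hz₀.2
  have h2' : 1 / 2 < ‖z₀‖ := by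
    refine lt_of_le_of_ne h2 fun he => ?_
    have h3 := hmin' z₀ he.ge
    have h4 : φ z₀ = 3 * c := by
      simp only [hφ, norm_inv, ← he]
      norm_num
      ring
    have h5 : ω z < φ z := hlt
    linarith
  have h1' : ‖z₀‖ < R := by
    refine lt_of_le_of_ne h1 fun he => ?_
    have h4 : φ z₀ = c * (R⁻¹ ^ 2 - 1) := by simp only [hφ, norm_inv, he]
    linarith [hpos z₀ (hKsub hz₀)]
  set U : Set ℂ := Metric.ball 0 R \ Metric.closedBall 0 (1 / 2) with hU
  have hUo : IsOpen U := Metric.isOpen_ball.sdiff Metric.isClosed_closedBall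
  have hUK : U ⊆ K := Set.sdiff_subset_sdiff Metric.ball_subset_closedBall
    Metric.ball_subset_closedBall
  have hz₀U : z₀ ∈ U := ⟨by simpa using h1', by simpa using h2'⟩
  obtain ⟨r, hr, hrU⟩ := Metric.nhds_basis_closedBall.mem_iff.mp (hUo.mem_nhds hz₀U)
  obtain ⟨N, hN, hN0, hNw⟩ := exists_le_sq_norm_on_sphere hUo
    (h := fun w => w⁻¹) (differentiableOn_inv.mono fun w hw => hKne w (hUK hw)) hz₀U r
  have hd : 0 < ‖deriv (fun w : ℂ => w⁻¹) z₀‖ := by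
    rw [deriv_inv, norm_pos_iff]
    have := hKne z₀ hz₀
    simp [this]
  set a := ‖deriv (fun w : ℂ => w⁻¹) z₀‖
  have key := ofReal_le_lintegral_circleMap (q := ω) (B := 0) (A := ω z₀ + c * (r ^ 2 * a ^ 2))
    (hN.const_mul (c : ℂ)) hr hrU (by simp [hN0]) le_rfl (by
      intro w hw
      have h3 := hNw w hw
      have h4 : ω z₀ + -φ z₀ ≤ ω w + -φ w :=
        hz₀min (hUK (hrU (Metric.sphere_subset_closedBall hw)))
      simp only [hφ] at h4
      have h5 := mul_le_mul_of_nonneg_left h3 hc0.le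
      rw [Complex.re_ofReal_mul]
      linarith)
  have h6 := key.trans (add_le_add_left (hω.lintegral_circleMap_le hr (hrU.trans (hUK.trans hKsub))) _)
  rw [mul_zero, ENNReal.ofReal_zero, add_zero, ENNReal.ofReal_le_ofReal_iff
    (mul_nonneg Real.two_pi_pos.le (hpos z₀ (hKsub hz₀)).le)] at h6
  have h7 : 0 < c * (r ^ 2 * a ^ 2) := by positivity
  have := le_of_mul_le_mul_left h6 Real.two_pi_pos
  linarith

end SuperharmonicOn

/-- A measurable, area-integrable weight vanishing off the disk whose circle means drop by at
least the square of the radius. -/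
structure IsStrictWeight (W : ℂ → ENNReal) : Prop where
  measurable : Measurable W
  lintegral_ne_top : ∫⁻ z, W z ≠ ⊤
  lintegral_circleMap_add_le : ∀ (z : ℂ) (r : ℝ), 0 < r → Metric.closedBall z r ⊆ unitDisk →
    (∫⁻ θ in Set.Ioc 0 (2 * Real.pi), W (circleMap z r θ)) + ENNReal.ofReal (2 * Real.pi * r ^ 2) ≤
      ENNReal.ofReal (2 * Real.pi) * W z

theorem SuperharmonicOn.exists_isStrictWeight {ω : ℂ → ℝ} (hω : SuperharmonicOn ω)
    (hpos : ∀ z ∈ unitDisk, 0 < ω z) :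
    ∃ W : ℂ → ENNReal, IsStrictWeight W ∧ (∀ z ∈ unitDisk, ENNReal.ofReal (ω z) ≤ W z) ∧
      ∃ C : ℝ, ∀ z ∈ unitDisk, W z ≤ ENNReal.ofReal (C * ω z) := by
  set v : ℂ → ℝ := fun z => 1 - ‖z‖ ^ 2 with hv
  have hv0 : ∀ z ∈ unitDisk, 0 ≤ v z := fun z hz => by
    have := mem_unitDisk.mp hz
    simp only [hv]
    nlinarith [norm_nonneg z]
  have hmω := hω.measurable_indicator
  have hmv : Measurable v := by fun_prop
  have hW : ∀ z ∈ unitDisk, unitDisk.indicator (fun z => ENNReal.ofReal (ω z + v z)) z =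
      ENNReal.ofReal (ω z + v z) := fun z hz => Set.indicator_of_mem hz _
  refine ⟨unitDisk.indicator fun z => ENNReal.ofReal (ω z + v z), ⟨?_, ?_, ?_⟩, ?_, ?_⟩
  · have h : (unitDisk.indicator fun z => ENNReal.ofReal (ω z + v z)) =
        unitDisk.indicator fun z => ENNReal.ofReal (unitDisk.indicator ω z + v z) := by
      refine Set.indicator_congr fun z hz => ?_
      rw [Set.indicator_of_mem hz]
    rw [h]
    exact ((hmω.add hmv).ennreal_ofReal).indicator measurableSet_unitDisk
  · rw [lintegral_indicator measurableSet_unitDisk]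
    have h : ∫⁻ z in unitDisk, ENNReal.ofReal (ω z + v z) ≤
        ∫⁻ z in unitDisk, (ENNReal.ofReal (ω z) + 1) := by
      refine setLIntegral_mono' measurableSet_unitDisk fun z hz => ?_
      refine ENNReal.ofReal_add_le.trans (add_le_add_right (ENNReal.ofReal_le_one.mpr ?_) _)
      simp [hv]
    refine (h.trans_lt ?_).ne
    rw [lintegral_add_right _ measurable_const]
    refine ENNReal.add_lt_top.mpr ⟨(hω.isIntegrableWeight hpos).lintegral_lt_top, ?_⟩
    rw [setLIntegral_const, one_mul]
    exact measure_ball_lt_top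
  · intro z r hr hz
    have hzd : z ∈ unitDisk := hz (Metric.mem_closedBall_self hr.le)
    have hmem : ∀ θ, circleMap z r θ ∈ unitDisk := fun θ =>
      hz (circleMap_mem_closedBall z hr.le θ)
    rw [hW z hzd]
    simp only [hW _ (hmem _)]
    have hωθ : Measurable fun θ => ENNReal.ofReal (v (circleMap z r θ)) :=
      (hmv.comp (continuous_circleMap z r).measurable).ennreal_ofReal
    have hadd : ∀ θ, ENNReal.ofReal (ω (circleMap z r θ) + v (circleMap z r θ)) =
        ENNReal.ofReal (ω (circleMap z r θ)) + ENNReal.ofReal (v (circleMap z r θ)) := fun θ =>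
      ENNReal.ofReal_add (hpos _ (hmem θ)).le (hv0 _ (hmem θ))
    simp only [hadd]
    rw [lintegral_add_right _ hωθ]
    have hN : DifferentiableOn ℂ (fun w => -2 * (starRingEnd ℂ z * (w - z))) Set.univ := by
      fun_prop
    obtain ⟨hi, he⟩ := setIntegral_re_circleMap hN hr (Set.subset_univ _)
    have hvθ : ∀ θ, v (circleMap z r θ) =
        (v z - r ^ 2) + (-2 * (starRingEnd ℂ z * (circleMap z r θ - z))).re := by
      intro θ
      have h1 := Complex.sq_norm_add z (circleMap z r θ - z)
      rw [add_sub_cancel] at h1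
      have h2 : ‖circleMap z r θ - z‖ = r := by simp [abs_of_pos hr]
      simp only [hv]
      rw [h1, h2, show ∀ x : ℂ, (-2 * x).re = -2 * x.re from fun x => by simp]
      ring
    have hint : ∫ θ in Set.Ioc 0 (2 * Real.pi), v (circleMap z r θ) =
        2 * Real.pi * (v z - r ^ 2) := by
      simp only [hvθ]
      rw [integral_add (by simp) hi, he]
      simp [Real.pi_pos.le]
    have hmean : ∫⁻ θ in Set.Ioc 0 (2 * Real.pi), ENNReal.ofReal (v (circleMap z r θ)) =
        ENNReal.ofReal (2 * Real.pi * (v z - r ^ 2)) := by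
      rw [← hint, ← ofReal_integral_eq_lintegral_ofReal]
      · simp only [hvθ]
        exact Integrable.add (by simp) hi
      · exact Filter.Eventually.of_forall fun θ => hv0 _ (hmem θ)
    have hvr : 0 ≤ v z - r ^ 2 := by
      have h : 0 ≤ ∫ θ in Set.Ioc 0 (2 * Real.pi), v (circleMap z r θ) :=
        integral_nonneg fun θ => hv0 _ (hmem θ)
      rw [hint] at h
      exact nonneg_of_mul_nonneg_right h Real.two_pi_pos
    rw [hmean, add_assoc, ← ENNReal.ofReal_add (by positivity) (by positivity), ← mul_add,
      sub_add_cancel, ← ENNReal.ofReal_mul Real.two_pi_pos.le]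
    refine (add_le_add_left (hω.lintegral_circleMap_le hr hz) _).trans_eq ?_
    rw [← ENNReal.ofReal_add (mul_nonneg Real.two_pi_pos.le (hpos z hzd).le)
      (mul_nonneg Real.two_pi_pos.le (hv0 z hzd)), mul_add]
  · intro z hz
    rw [hW z hz]
    exact ENNReal.ofReal_le_ofReal (by linarith [hv0 z hz])
  · obtain ⟨c, hc, hcω⟩ := hω.exists_mul_one_sub_sq_le hpos
    refine ⟨1 + c⁻¹, fun z hz => ?_⟩
    rw [hW z hz]
    refine ENNReal.ofReal_le_ofReal ?_
    have := mul_le_mul_of_nonneg_left (hcω z hz) (inv_nonneg.mpr hc.le)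
    rw [inv_mul_cancel_left₀ hc.ne'] at this
    simp only [hv]
    linarith

theorem IsStrictWeight.lintegral_mul_circleMap_add_le {W : ℂ → ENNReal} (hW : IsStrictWeight W)
    {P : ℂ → ENNReal} (hP : Measurable P) {ε : ℝ} (hε : 0 < ε)
    (hPε : ∀ z, ¬ Metric.closedBall z ε ⊆ unitDisk → P z = 0) :
    (∫⁻ z, W z * ∫⁻ θ in Set.Ioc 0 (2 * Real.pi), P (circleMap z ε θ)) +
        ENNReal.ofReal (2 * Real.pi * ε ^ 2) * ∫⁻ z, P z ≤
      ENNReal.ofReal (2 * Real.pi) * ∫⁻ z, W z * P z := by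
  have hcm : ∀ r : ℝ, Measurable fun p : ℂ × ℝ => circleMap p.1 r p.2 := fun r => by
    unfold circleMap
    fun_prop
  have hcθ : ∀ (r : ℝ) (z : ℂ), Measurable fun θ => circleMap z r θ := fun r z =>
    (continuous_circleMap z r).measurable
  have hswap : (∫⁻ z, W z * ∫⁻ θ in Set.Ioc 0 (2 * Real.pi), P (circleMap z ε θ)) =
      ∫⁻ z, P z * ∫⁻ θ in Set.Ioc 0 (2 * Real.pi), W (circleMap z ε θ) := by
    calc _ = ∫⁻ z, ∫⁻ θ in Set.Ioc 0 (2 * Real.pi), W z * P (circleMap z ε θ) := by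
          refine lintegral_congr fun z => ?_
          rw [lintegral_const_mul _ (by exact hP.comp (hcθ ε z))]
      _ = ∫⁻ θ in Set.Ioc 0 (2 * Real.pi), ∫⁻ z, W z * P (circleMap z ε θ) :=
          lintegral_lintegral_swap
            ((hW.measurable.comp measurable_fst).mul (hP.comp (hcm ε))).aemeasurable
      _ = ∫⁻ θ in Set.Ioc 0 (2 * Real.pi), ∫⁻ z, P z * W (circleMap z (-ε) θ) := by
          refine lintegral_congr fun θ => ?_
          rw [← lintegral_add_right_eq_self (fun z => P z * W (circleMap z (-ε) θ))
            (ε * Complex.exp (θ * Complex.I))]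
          refine lintegral_congr fun z => ?_
          simp [circleMap, mul_comm]
      _ = ∫⁻ z, ∫⁻ θ in Set.Ioc 0 (2 * Real.pi), P z * W (circleMap z (-ε) θ) :=
          (lintegral_lintegral_swap
            ((hP.comp measurable_fst).mul (hW.measurable.comp (hcm (-ε)))).aemeasurable).symm
      _ = _ := by
          refine lintegral_congr fun z => ?_
          rw [lintegral_const_mul _ (by exact hW.measurable.comp (hcθ (-ε) z)),
            lintegral_circleMap_neg_radius W]
  rw [hswap, ← lintegral_const_mul _ hP, ← lintegral_const_mul _ (by exact hW.measurable.mul hP),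
    ← lintegral_add_right _ (hP.const_mul _)]
  refine lintegral_mono fun z => ?_
  by_cases hz : Metric.closedBall z ε ⊆ unitDisk
  · calc _ = P z * ((∫⁻ θ in Set.Ioc 0 (2 * Real.pi), W (circleMap z ε θ)) +
          ENNReal.ofReal (2 * Real.pi * ε ^ 2)) := by rw [mul_add, mul_comm (P z) (ENNReal.ofReal _)]
      _ ≤ P z * (ENNReal.ofReal (2 * Real.pi) * W z) :=
          mul_le_mul_right (hW.lintegral_circleMap_add_le z ε hε hz) _
      _ = _ := by ring
  · simp [hPε z hz]

/-- Sub-mean-value inequality, with gain `ε ^ 2 * ‖g' z‖ ^ 2 / 2`, for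
`(re g) ^ 2 - ‖f‖ ^ 2 + (a - ‖z‖ ^ 2)`. -/
theorem ofReal_sq_re_sub_sq_norm_le {f g : ℂ → ℂ} (hf : DifferentiableOn ℂ f unitDisk)
    (hg : DifferentiableOn ℂ g unitDisk) {z : ℂ} {ε : ℝ} (hε : 0 < ε)
    (hz : Metric.closedBall z ε ⊆ unitDisk) {M a : ℝ}
    (hM : ∀ w ∈ Metric.closedBall z ε, ‖deriv f w‖ ^ 2 ≤ M) {q : ℂ → ℝ}
    (hq : ∀ w ∈ Metric.sphere z ε, (g w).re ^ 2 - ‖f w‖ ^ 2 + (a - ‖w‖ ^ 2) ≤ q w) :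
    ENNReal.ofReal (2 * Real.pi * ((g z).re ^ 2 - ‖f z‖ ^ 2 + (a - ‖z‖ ^ 2) +
        1 / 2 * ε ^ 2 * ‖deriv g z‖ ^ 2)) ≤
      (∫⁻ θ in Set.Ioc 0 (2 * Real.pi), ENNReal.ofReal (q (circleMap z ε θ))) +
        ENNReal.ofReal (2 * Real.pi * (ε ^ 2 * (M + 1))) := by
  have hzz : z ∈ Metric.closedBall z ε := Metric.mem_closedBall_self hε.le
  have hM0 : 0 ≤ M := (sq_nonneg _).trans (hM z hzz)
  obtain ⟨N, hN, hN0, hNw⟩ := exists_le_sq_norm_on_sphere isOpen_unitDisk hg (hz hzz) ε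
  refine ofReal_le_lintegral_circleMap
    (N := fun w => 1 / 2 * (N w + (g w ^ 2 - g z ^ 2)) -
      2 * (starRingEnd ℂ (f z) * (f w - f z)) - 2 * (starRingEnd ℂ z * (w - z)))
    (by fun_prop) hε hz (by simp [hN0]) (by positivity) fun w hw => ?_
  have hwz : ‖w - z‖ = ε := by simpa [dist_eq_norm] using hw
  have hwc : w ∈ Metric.closedBall z ε := Metric.sphere_subset_closedBall hw
  have h1 := hNw w hw
  have h2 := Complex.sq_norm_add (f z) (f w - f z)
  have h3 := Complex.sq_norm_add z (w - z)
  rw [add_sub_cancel] at h2 h3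
  rw [hwz] at h3
  have h4 : ‖f w - f z‖ ^ 2 ≤ ε ^ 2 * M := by
    have h5 := (convex_closedBall z ε).norm_image_sub_le_of_norm_deriv_le (𝕜 := ℂ) (f := f)
      (C := Real.sqrt M) (fun x hx => hf.differentiableAt (isOpen_unitDisk.mem_nhds (hz hx)))
      (fun x hx => Real.le_sqrt_of_sq_le (hM x hx)) hzz hwc
    rw [hwz] at h5
    have h6 := pow_le_pow_left₀ (norm_nonneg _) h5 2
    rw [mul_pow, Real.sq_sqrt hM0] at h6
    linarith
  have h7 : ∀ x : ℂ, (x ^ 2).re = 2 * x.re ^ 2 - ‖x‖ ^ 2 := fun x => by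
    rw [Complex.sq_norm, Complex.normSq_apply, pow_two, Complex.mul_re]
    ring
  have h8 : ∀ A B C D E : ℂ, (1 / 2 * (A + (B - C)) - 2 * D - 2 * E).re =
      1 / 2 * (A.re + (B.re - C.re)) - 2 * D.re - 2 * E.re := fun A B C D E => by
    simp [Complex.mul_re]
  rw [h8, h7, h7]
  linarith [hq w hw]

theorem IsStrictWeight.lintegral_energy_le {W : ℂ → ENNReal} (hW : IsStrictWeight W)
    {f g : ℂ → ℂ} (hf : DifferentiableOn ℂ f unitDisk) (hg : DifferentiableOn ℂ g unitDisk)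
    {R : ℝ} (hR0 : 0 < R) (hR1 : R < 1) {a : ℝ} {Q : ℂ → ℝ}
    (hQ : ∀ z, Q z = (g z).re ^ 2 - ‖f z‖ ^ 2 + (a - ‖z‖ ^ 2))
    (hQR : ∀ z ∈ Metric.sphere 0 R, Q z < 0) :
    (∫⁻ z in {z ∈ Metric.ball 0 R | 0 < Q z}, ENNReal.ofReal (1 / 2 * ‖deriv g z‖ ^ 2) * W z) +
        ∫⁻ z in Metric.ball 0 R, ENNReal.ofReal (Q z) ≤
      ∫⁻ z in unitDisk, ENNReal.ofReal (‖deriv f z‖ ^ 2 + 2) * W z := by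
  classical
  have hQc : ContinuousOn Q unitDisk := by
    have hfc := hf.continuousOn
    have hgc := hg.continuousOn
    have h : Q = fun z => (g z).re ^ 2 - ‖f z‖ ^ 2 + (a - ‖z‖ ^ 2) := funext hQ
    rw [h]
    exact (((Complex.continuous_re.comp_continuousOn hgc).pow 2).sub (hfc.norm.pow 2)).add
      (by fun_prop)
  have hR : Metric.closedBall (0 : ℂ) R ⊆ unitDisk := Metric.closedBall_subset_ball hR1
  have hbR : Metric.ball (0 : ℂ) R ⊆ unitDisk := Metric.ball_subset_closedBall.trans hR
  have hbm : MeasurableSet (Metric.ball (0 : ℂ) R) := Metric.isOpen_ball.measurableSet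
  obtain ⟨ε₁, hε₁, hthick⟩ := (isCompact_sphere (0 : ℂ) R).exists_cthickening_subset_open
    (hQc.isOpen_inter_preimage isOpen_unitDisk isOpen_Iio)
    fun z hz => ⟨hR (Metric.sphere_subset_closedBall hz), hQR z hz⟩
  have hR' : Metric.closedBall (0 : ℂ) ((1 + R) / 2) ⊆ unitDisk :=
    Metric.closedBall_subset_ball (by linarith)
  obtain ⟨ε₂, hε₂, hunif⟩ := Metric.uniformContinuousOn_iff.mp
    ((isCompact_closedBall (0 : ℂ) ((1 + R) / 2)).uniformContinuousOn_of_continuous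
      ((((hf.deriv isOpen_unitDisk).continuousOn.mono hR').norm).pow 2)) 1 one_pos
  obtain ⟨ε, hε, hle₁, hle₂, hleR⟩ : ∃ ε > 0, ε ≤ ε₁ ∧ ε < ε₂ ∧ ε ≤ (1 - R) / 2 :=
    ⟨min ε₁ (min (ε₂ / 2) ((1 - R) / 2)),
      lt_min hε₁ (lt_min (by linarith) (by linarith)), min_le_left _ _,
      ((min_le_right _ _).trans (min_le_left _ _)).trans_lt (by linarith),
      (min_le_right _ _).trans (min_le_right _ _)⟩
  have hsub : ∀ z ∈ Metric.ball (0 : ℂ) R,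
      Metric.closedBall z ε ⊆ Metric.closedBall 0 ((1 + R) / 2) := fun z hz =>
    Metric.closedBall_subset_closedBall' (by linarith [Metric.mem_ball.mp hz])
  set P : ℂ → ENNReal := (Metric.ball 0 R).indicator fun z => ENNReal.ofReal (Q z) with hP
  have hPm : Measurable P := by
    rw [hP, ← Set.piecewise_eq_indicator]
    exact ContinuousOn.measurable_piecewise
      (ENNReal.continuous_ofReal.comp_continuousOn (hQc.mono hbR)) continuousOn_const hbm
  have hPq : ∀ w, ENNReal.ofReal ((Metric.ball (0 : ℂ) R).indicator Q w) = P w := fun w => by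
    by_cases hw : w ∈ Metric.ball (0 : ℂ) R
    · rw [hP, Set.indicator_of_mem hw, Set.indicator_of_mem hw]
    · rw [hP, Set.indicator_of_notMem hw, Set.indicator_of_notMem hw, ENNReal.ofReal_zero]
  set E : Set ℂ := {z ∈ Metric.ball 0 R | 0 < Q z} with hE
  have hEm : MeasurableSet E :=
    ((hQc.mono hbR).isOpen_inter_preimage Metric.isOpen_ball isOpen_Ioi).measurableSet
  have hPE : ∀ z ∉ E, P z = 0 := fun z hz => by
    by_cases hw : z ∈ Metric.ball (0 : ℂ) R
    · rw [hP, Set.indicator_of_mem hw]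
      exact ENNReal.ofReal_of_nonpos (not_lt.mp fun h => hz ⟨hw, h⟩)
    · rw [hP, Set.indicator_of_notMem hw]
  have hpt : ∀ z ∈ E, ENNReal.ofReal (2 * Real.pi) * P z +
      ENNReal.ofReal (2 * Real.pi * ε ^ 2) * ENNReal.ofReal (1 / 2 * ‖deriv g z‖ ^ 2) ≤
      (∫⁻ θ in Set.Ioc 0 (2 * Real.pi), P (circleMap z ε θ)) +
        ENNReal.ofReal (2 * Real.pi * ε ^ 2) * ENNReal.ofReal (‖deriv f z‖ ^ 2 + 2) := by
    intro z hz
    have hzR := hsub z hz.1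
    have h := ofReal_sq_re_sub_sq_norm_le (a := a) (M := ‖deriv f z‖ ^ 2 + 1) hf hg hε
      (hzR.trans hR') (fun w hw => by
        have h1 := hunif w (hzR hw) z (hzR (Metric.mem_closedBall_self hε.le))
          ((Metric.mem_closedBall.mp hw).trans_lt hle₂)
        simp only [Pi.pow_apply, Real.dist_eq] at h1
        linarith [le_abs_self (‖deriv f w‖ ^ 2 - ‖deriv f z‖ ^ 2)])
      (q := (Metric.ball (0 : ℂ) R).indicator Q) (fun w hw => by
        rw [← hQ]
        by_cases hwR : w ∈ Metric.ball (0 : ℂ) R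
        · rw [Set.indicator_of_mem hwR]
        · rw [Set.indicator_of_notMem hwR]
          have hwn : R ≤ ‖w‖ := by simpa using hwR
          have hw0 : 0 < ‖w‖ := hR0.trans_le hwn
          have hzn : ‖z‖ < R := by simpa using hz.1
          have hwz : ‖w - z‖ = ε := by simpa [dist_eq_norm] using hw
          have hmem : ((R / ‖w‖ : ℝ) : ℂ) * w ∈ Metric.sphere (0 : ℂ) R := by
            rw [mem_sphere_zero_iff_norm, norm_mul, Complex.norm_real,
              Real.norm_of_nonneg (by positivity), div_mul_cancel₀ _ hw0.ne']
          refine (hthick (Metric.mem_cthickening_of_dist_le _ _ _ _ hmem ?_)).2.le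
          have h2 : w - ((R / ‖w‖ : ℝ) : ℂ) * w = ((1 - R / ‖w‖ : ℝ) : ℂ) * w := by
            push_cast
            ring
          have h3 : 0 ≤ 1 - R / ‖w‖ := sub_nonneg.mpr ((div_le_one hw0).mpr hwn)
          rw [dist_eq_norm, h2, norm_mul, Complex.norm_real, Real.norm_of_nonneg h3, sub_mul,
            div_mul_cancel₀ _ hw0.ne']
          linarith [norm_sub_norm_le w z])
    rw [← hQ] at h
    simp only [hPq] at h
    have hPz : P z = ENNReal.ofReal (Q z) := Set.indicator_of_mem hz.1 _
    rw [hPz, ← ENNReal.ofReal_mul (by positivity), ← ENNReal.ofReal_mul (by positivity),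
      ← ENNReal.ofReal_mul (by positivity), ← ENNReal.ofReal_add
        (mul_nonneg Real.two_pi_pos.le hz.2.le) (by positivity)]
    convert h using 2 <;> ring_nf
  have hmg : ∀ f : ℂ → ℂ, ∀ c d : ℝ,
      Measurable fun z => ENNReal.ofReal (c * ‖deriv f z‖ ^ 2 + d) * W z := fun f c d =>
    ((((measurable_deriv f).norm.pow_const 2).const_mul c).add_const d).ennreal_ofReal.mul
      hW.measurable
  have hmg1 : Measurable fun z => ENNReal.ofReal (1 / 2 * ‖deriv g z‖ ^ 2) * W z := by
    simpa using hmg g (1 / 2) 0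
  have hmf : Measurable fun z => ENNReal.ofReal (‖deriv f z‖ ^ 2 + 2) * W z := by
    simpa using hmg f 1 2
  have hWP : Measurable fun z => W z * P z := hW.measurable.mul hPm
  have hEWP : ∫⁻ z in E, W z * P z = ∫⁻ z, W z * P z := by
    rw [← lintegral_indicator hEm]
    refine lintegral_congr fun z => ?_
    by_cases hz : z ∈ E
    · rw [Set.indicator_of_mem hz]
    · rw [Set.indicator_of_notMem hz, hPE z hz, mul_zero]
  have hfin : ∫⁻ z, W z * P z ≠ ⊤ := by
    obtain ⟨B, hB⟩ := (isCompact_closedBall (0 : ℂ) R).exists_bound_of_continuousOn (hQc.mono hR)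
    have h : ∫⁻ z, W z * P z ≤ ∫⁻ z, W z * ENNReal.ofReal B := by
      refine lintegral_mono fun z => mul_le_mul_right ?_ _
      by_cases hw : z ∈ Metric.ball (0 : ℂ) R
      · rw [hP, Set.indicator_of_mem hw]
        exact ENNReal.ofReal_le_ofReal
          ((le_abs_self _).trans (hB z (Metric.ball_subset_closedBall hw)))
      · rw [hP, Set.indicator_of_notMem hw]
        exact zero_le
    rw [lintegral_mul_const _ hW.measurable] at h
    exact (h.trans_lt (ENNReal.mul_lt_top hW.lintegral_ne_top.lt_top ENNReal.ofReal_lt_top)).ne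
  have hconv := hW.lintegral_mul_circleMap_add_le hPm hε fun z hz =>
    Set.indicator_of_notMem (fun hzb => hz ((hsub z hzb).trans hR')) _
  set k := ENNReal.ofReal (2 * Real.pi * ε ^ 2) with hk
  have hsum : ENNReal.ofReal (2 * Real.pi) * (∫⁻ z, W z * P z) +
      k * (∫⁻ z in E, ENNReal.ofReal (1 / 2 * ‖deriv g z‖ ^ 2) * W z) ≤
      (∫⁻ z, W z * ∫⁻ θ in Set.Ioc 0 (2 * Real.pi), P (circleMap z ε θ)) +
        k * ∫⁻ z in unitDisk, ENNReal.ofReal (‖deriv f z‖ ^ 2 + 2) * W z := by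
    rw [← hEWP, ← lintegral_const_mul _ hWP, ← lintegral_const_mul _ hmg1,
      ← lintegral_add_left (hWP.const_mul _)]
    calc _ ≤ ∫⁻ z in E, (W z * (∫⁻ θ in Set.Ioc 0 (2 * Real.pi), P (circleMap z ε θ)) +
          k * (ENNReal.ofReal (‖deriv f z‖ ^ 2 + 2) * W z)) := by
          refine setLIntegral_mono' hEm fun z hz => ?_
          calc _ = W z * (ENNReal.ofReal (2 * Real.pi) * P z +
                k * ENNReal.ofReal (1 / 2 * ‖deriv g z‖ ^ 2)) := by ring
            _ ≤ W z * _ := mul_le_mul_right (hpt z hz) _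
            _ = _ := by ring
      _ ≤ _ := by
          rw [lintegral_add_right _ (hmf.const_mul _), ← lintegral_const_mul _ hmf]
          exact add_le_add (setLIntegral_le_lintegral _ _)
            (lintegral_mono_set fun z hz => hbR hz.1)
  have hPint : ∫⁻ z, P z = ∫⁻ z in Metric.ball 0 R, ENNReal.ofReal (Q z) :=
    lintegral_indicator hbm _
  rw [hPint] at hconv
  have hk0 : k ≠ 0 := by
    rw [hk, Ne, ENNReal.ofReal_eq_zero, not_le]
    positivity
  rw [← ENNReal.mul_le_mul_iff_right hk0 ENNReal.ofReal_ne_top, mul_add]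
  refine (ENNReal.add_le_add_iff_left
    (ENNReal.mul_ne_top (ENNReal.ofReal_ne_top (r := 2 * Real.pi)) hfin)).mp ?_
  rw [← add_assoc]
  refine (add_le_add_left hsum _).trans ?_
  rw [add_right_comm]
  exact add_le_add_left hconv _

/-- A continuous real function on a circle is uniformly approximated by real parts of
entire functions. -/
theorem exists_differentiable_abs_re_sub_le {φ : ℂ → ℝ} {R : ℝ} (hR : 0 < R)
    (hφ : ContinuousOn φ (Metric.sphere 0 R)) {η : ℝ} (hη : 0 < η) :
    ∃ g : ℂ → ℂ, Differentiable ℂ g ∧ (g 0).im = 0 ∧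
      ∀ z ∈ Metric.sphere (0 : ℂ) R, |(g z).re - φ z| ≤ η := by
  have hmem : ∀ x : AddCircle (1 : ℝ), (R : ℂ) * (AddCircle.toCircle x : ℂ) ∈
      Metric.sphere (0 : ℂ) R := fun x => by simp [abs_of_pos hR, Circle.norm_coe]
  let F : C(AddCircle (1 : ℝ), ℂ) := ⟨fun x => (φ (R * (AddCircle.toCircle x : ℂ)) : ℂ), by
    refine Complex.continuous_ofReal.comp (hφ.comp_continuous ?_ hmem)
    exact continuous_const.mul (continuous_subtype_val.comp AddCircle.continuous_toCircle)⟩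
  have hspan : ∀ p ∈ Submodule.span ℂ (Set.range (fourier (T := (1 : ℝ)))), ∀ c : ℂ,
      ∃ g : ℂ → ℂ, Differentiable ℂ g ∧
        ∀ x, (c * p x).re = (g (R * (AddCircle.toCircle x : ℂ))).re := by
    intro p hp
    induction hp using Submodule.span_induction with
    | mem p hp =>
      obtain ⟨n, rfl⟩ := hp
      intro c
      have hR' : (R : ℂ) ≠ 0 := by exact_mod_cast hR.ne'
      obtain ⟨m, rfl | rfl⟩ := n.eq_nat_or_neg
      · refine ⟨fun z => c * (z / R) ^ m, by fun_prop, fun x => ?_⟩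
        simp [mul_div_cancel_left₀ _ hR', fourier_apply, AddCircle.toCircle_nsmul]
      · refine ⟨fun z => starRingEnd ℂ c * (z / R) ^ m, by fun_prop, fun x => ?_⟩
        rw [← Complex.conj_re (c * _), map_mul, ← fourier_neg, neg_neg]
        simp [mul_div_cancel_left₀ _ hR', fourier_apply, AddCircle.toCircle_nsmul]
    | zero => exact fun c => ⟨fun _ => 0, by fun_prop, by simp⟩
    | add p q _ _ ihp ihq =>
      intro c
      obtain ⟨g, hg, hgp⟩ := ihp c
      obtain ⟨h, hh, hhq⟩ := ihq c
      refine ⟨fun z => g z + h z, hg.add hh, fun x => ?_⟩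
      rw [Complex.add_re, ← hgp, ← hhq, ← Complex.add_re, ← mul_add]
      rfl
    | smul a p _ ih =>
      intro c
      obtain ⟨g, hg, hgp⟩ := ih (c * a)
      refine ⟨g, hg, fun x => ?_⟩
      rw [← hgp, mul_assoc]
      rfl
  have hF : F ∈ closure (Submodule.span ℂ (Set.range (fourier (T := (1 : ℝ)))) :
      Set C(AddCircle (1 : ℝ), ℂ)) := by
    rw [← Submodule.topologicalClosure_coe, span_fourier_closure_eq_top]
    trivial
  obtain ⟨p, hp, hpF⟩ := Metric.mem_closure_iff.mp hF η hη
  obtain ⟨g, hg, hgp⟩ := hspan p hp 1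
  refine ⟨fun z => g z - ((g 0).im : ℂ) * Complex.I, hg.sub_const _, by simp, fun z hz => ?_⟩
  obtain ⟨x, hx⟩ : ∃ x : AddCircle (1 : ℝ), (R : ℂ) * (AddCircle.toCircle x : ℂ) = z := by
    have hzR : ‖z / R‖ = 1 := by
      rw [norm_div, mem_sphere_zero_iff_norm.mp hz, Complex.norm_real,
        Real.norm_of_nonneg hR.le, div_self hR.ne']
    obtain ⟨x, hx⟩ := (AddCircle.homeomorphCircle (one_ne_zero (α := ℝ))).surjective
      ⟨z / R, mem_sphere_zero_iff_norm.mpr hzR⟩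
    refine ⟨x, ?_⟩
    rw [AddCircle.homeomorphCircle_apply] at hx
    rw [hx]
    exact mul_div_cancel₀ z (by exact_mod_cast hR.ne')
  have h1 := hgp x
  rw [one_mul, hx] at h1
  have h2 : (g z - ((g 0).im : ℂ) * Complex.I).re - φ z = -(F x - p x).re := by
    have h3 : F x = (φ z : ℂ) := by simp [F, hx]
    rw [h3]
    simp [h1]
  rw [h2, abs_neg]
  refine (Complex.abs_re_le_norm _).trans ?_
  rw [← dist_eq_norm]
  exact (ContinuousMap.dist_apply_le_dist x).trans hpF.le

/-- Domination of `‖f‖` by `re g` propagates from a circle to the disk it bounds. -/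
theorem norm_le_re_of_forall_mem_sphere {f g : ℂ → ℂ} {R : ℝ} (hR : 0 < R)
    (hf : DifferentiableOn ℂ f (Metric.closedBall 0 R)) (hg : Differentiable ℂ g)
    (hfg : ∀ z ∈ Metric.sphere 0 R, ‖f z‖ ≤ (g z).re) :
    ∀ z ∈ Metric.ball 0 R, ‖f z‖ ≤ (g z).re := by
  intro z hz
  obtain ⟨c, hc, hcf⟩ : ∃ c : ℂ, ‖c‖ = 1 ∧ c * f z = ‖f z‖ := by
    rcases eq_or_ne (f z) 0 with h0 | h0
    · exact ⟨1, by simp, by simp [h0]⟩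
    · have h1 : ‖f z‖ ≠ 0 := norm_ne_zero_iff.mpr h0
      exact ⟨‖f z‖ / f z, by simp [h1], div_mul_cancel₀ _ h0⟩
  have hd : DiffContOnCl ℂ (fun w => Complex.exp (c * f w - g w)) (Metric.ball 0 R) := by
    refine DifferentiableOn.diffContOnCl ?_
    rw [closure_ball _ hR.ne']
    exact ((hf.const_mul c).sub hg.differentiableOn).cexp
  have h := Complex.norm_le_of_forall_mem_frontier_norm_le Metric.isBounded_ball hd (C := 1)
    (fun w hw => by
      rw [frontier_ball _ hR.ne'] at hw
      rw [Complex.norm_exp, Real.exp_le_one_iff, Complex.sub_re, sub_nonpos]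
      refine (Complex.re_le_norm _).trans ?_
      rw [norm_mul, hc, one_mul]
      exact hfg w hw) (subset_closure hz)
  rw [Complex.norm_exp, Real.exp_le_one_iff, hcf, Complex.sub_re, Complex.ofReal_re,
    sub_nonpos] at h
  exact h

theorem IsStrictWeight.exists_differentiable_norm_le_re {W : ℂ → ENNReal} (hW : IsStrictWeight W)
    {f : ℂ → ℂ} (hf : DifferentiableOn ℂ f unitDisk) {r : ℝ} (hr0 : 0 < r) (hr1 : r < 1) :
    ∃ g : ℂ → ℂ, Differentiable ℂ g ∧ (g 0).im = 0 ∧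
      (∀ z ∈ Metric.ball 0 r, ‖f z‖ ≤ (g z).re) ∧
      (∫⁻ z in Metric.ball 0 r, ENNReal.ofReal (1 / 2 * ‖deriv g z‖ ^ 2) * W z) +
          ∫⁻ z in Metric.ball 0 r, ENNReal.ofReal ((g z).re ^ 2 - ‖f z‖ ^ 2) ≤
        ∫⁻ z in unitDisk, ENNReal.ofReal (‖deriv f z‖ ^ 2 + 2) * W z := by
  obtain ⟨R, hrR, hR1⟩ := exists_between hr1
  have hR0 := hr0.trans hrR
  set δ := (R ^ 2 - r ^ 2) / 2 with hδ
  have hδ0 : 0 < δ := by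
    rw [hδ]
    nlinarith
  have hcb : Metric.closedBall (0 : ℂ) R ⊆ unitDisk := Metric.closedBall_subset_ball hR1
  have hfc : ContinuousOn f (Metric.sphere 0 R) :=
    hf.continuousOn.mono (Metric.sphere_subset_closedBall.trans hcb)
  obtain ⟨B, hB⟩ := (isCompact_sphere (0 : ℂ) R).exists_bound_of_continuousOn hfc
  have hB0 : 0 ≤ B := (norm_nonneg _).trans (hB (R : ℂ) (by simp [abs_of_pos hR0]))
  set η := min 1 (δ / (8 * (B + 1))) with hη
  have hη0 : 0 < η := lt_min one_pos (by positivity)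
  have hη1 : η ≤ 1 := min_le_left _ _
  have hηδ : η * (8 * (B + 1)) ≤ δ :=
    (le_div_iff₀ (by positivity)).mp (min_le_right _ _)
  obtain ⟨g, hg, hg0, hgφ⟩ := exists_differentiable_abs_re_sub_le hR0
    (φ := fun z => ‖f z‖ + η) (hfc.norm.add continuousOn_const) hη0
  have hsph : ∀ z ∈ Metric.sphere (0 : ℂ) R, ‖f z‖ ≤ (g z).re ∧ (g z).re ≤ ‖f z‖ + 2 * η := by
    intro z hz
    obtain ⟨h1, h2⟩ := abs_le.mp (hgφ z hz)
    constructor <;> linarith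
  have hball := norm_le_re_of_forall_mem_sphere hR0 (hf.mono hcb) hg fun z hz => (hsph z hz).1
  have hrb : Metric.ball (0 : ℂ) r ⊆ Metric.ball 0 R := Metric.ball_subset_ball hrR.le
  refine ⟨g, hg, hg0, fun z hz => hball z (hrb hz), ?_⟩
  have key := hW.lintegral_energy_le hf hg.differentiableOn hR0 hR1 (a := R ^ 2 - δ)
    (Q := fun z => (g z).re ^ 2 - ‖f z‖ ^ 2 + (R ^ 2 - δ - ‖z‖ ^ 2)) (fun z => rfl) (by
      intro z hz
      obtain ⟨h1, h2⟩ := hsph z hz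
      have h3 := hB z hz
      have h4 : (g z).re ^ 2 ≤ (‖f z‖ + 2 * η) ^ 2 :=
        pow_le_pow_left₀ ((norm_nonneg _).trans h1) h2 2
      rw [mem_sphere_zero_iff_norm.mp hz]
      nlinarith [mul_le_mul_of_nonneg_right h3 hη0.le])
  have hQ : ∀ z ∈ Metric.ball (0 : ℂ) r, δ < R ^ 2 - ‖z‖ ^ 2 := fun z hz => by
    have h1 : ‖z‖ < r := by simpa using hz
    have h2 : ‖z‖ ^ 2 < r ^ 2 := pow_lt_pow_left₀ h1 (norm_nonneg _) two_ne_zero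
    linarith
  refine le_trans (add_le_add (lintegral_mono_set ?_) ?_) key
  · intro z hz
    refine ⟨hrb hz, ?_⟩
    have h1 := hball z (hrb hz)
    have h2 : ‖f z‖ ^ 2 ≤ (g z).re ^ 2 := pow_le_pow_left₀ (norm_nonneg _) h1 2
    linarith [hQ z hz]
  · refine (setLIntegral_mono' Metric.isOpen_ball.measurableSet fun z hz => ?_).trans
      (lintegral_mono_set hrb)
    exact ENNReal.ofReal_le_ofReal (by linarith [hQ z hz])

theorem ofReal_sq_re_le_lintegral_ball {g : ℂ → ℂ} (hg : Differentiable ℂ g) :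
    ENNReal.ofReal ((g 0).re ^ 2) ≤
      16 * ∫⁻ z in Metric.ball 0 (1 / 2), ENNReal.ofReal ((g z).re ^ 2) := by
  have hm : Measurable fun z => ENNReal.ofReal ((g z).re ^ 2) :=
    ((Complex.continuous_re.comp hg.continuous).pow 2).measurable.ennreal_ofReal
  have hcirc : ∀ r : ℝ, 0 < r → ENNReal.ofReal (2 * Real.pi * (g 0).re ^ 2) ≤
      ∫⁻ θ in Set.Ioc 0 (2 * Real.pi), ENNReal.ofReal ((g (circleMap 0 r θ)).re ^ 2) := by
    intro r hr
    have h := ofReal_le_lintegral_circleMap (U := Set.univ) (z := 0)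
      (N := fun w => ((2 * (g 0).re : ℝ) : ℂ) * (g w - g 0)) (A := (g 0).re ^ 2) (B := 0)
      (q := fun w => (g w).re ^ 2) (by fun_prop) hr (Set.subset_univ _) (by simp) le_rfl
      (fun w _ => by
        rw [Complex.re_ofReal_mul, Complex.sub_re]
        nlinarith [sq_nonneg ((g w).re - (g 0).re)])
    simpa using h
  rw [lintegral_ball_eq_polar hm]
  calc ENNReal.ofReal ((g 0).re ^ 2)
      = 16 * ∫⁻ r in Set.Ioo (1 / 4 : ℝ) (1 / 2), ENNReal.ofReal (1 / 4) *
          ENNReal.ofReal ((g 0).re ^ 2) := by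
        have h : 16 * ENNReal.ofReal (1 / 4) * ENNReal.ofReal (1 / 2 - 1 / 4) = 1 := by
          rw [show (16 : ENNReal) = ENNReal.ofReal 16 by simp, ← ENNReal.ofReal_mul (by norm_num),
            ← ENNReal.ofReal_mul (by norm_num)]
          norm_num
        rw [setLIntegral_const, Real.volume_Ioo]
        nth_rewrite 1 [← one_mul (ENNReal.ofReal ((g 0).re ^ 2)), ← h]
        ring
    _ ≤ _ := by
        refine mul_le_mul_right ?_ _
        refine (setLIntegral_mono' measurableSet_Ioo fun r hr => ?_).trans
          (lintegral_mono_set (Set.Ioo_subset_Ioo_left (by norm_num)))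
        refine mul_le_mul' (ENNReal.ofReal_le_ofReal hr.1.le)
          (le_trans (ENNReal.ofReal_le_ofReal ?_) (hcirc r (by linarith [hr.1])))
        nlinarith [Real.two_le_pi, sq_nonneg (g 0).re]

/-- A family of entire functions that is locally bounded on a set along an ultrafilter
converges locally uniformly there. -/
theorem exists_tendstoLocallyUniformlyOn_of_bounded {ι : Type*} {U : Set ℂ}
    {l : Ultrafilter ι} {G : ι → ℂ → ℂ} (hG : ∀ n, Differentiable ℂ (G n))
    (hbdd : ∀ z ∈ U, ∃ ρ > 0, ∃ B : ℝ, ∀ᶠ n in (l : Filter ι),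
      ∀ w ∈ Metric.ball z ρ, ‖G n w‖ ≤ B) :
    ∃ g : ℂ → ℂ, TendstoLocallyUniformlyOn G g (l : Filter ι) U := by
  have hlim : ∀ z, ∃ c, z ∈ U → Filter.Tendsto (fun n => G n z) (l : Filter ι) (nhds c) := by
    intro z
    by_cases hz : z ∈ U
    · obtain ⟨ρ, hρ, B, hB⟩ := hbdd z hz
      have h1 : ((l.map fun n => G n z : Ultrafilter ℂ) : Filter ℂ) ≤
          Filter.principal (Metric.closedBall 0 B) := by
        rw [Filter.le_principal_iff, Ultrafilter.coe_map, Filter.mem_map]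
        filter_upwards [hB] with n hn
        simpa using hn z (Metric.mem_ball_self hρ)
      obtain ⟨c, -, hc⟩ := (isCompact_closedBall (0 : ℂ) B).ultrafilter_le_nhds _ h1
      exact ⟨c, fun _ => hc⟩
    · exact ⟨0, fun h => absurd h hz⟩
  choose g hg using hlim
  refine ⟨g, Metric.tendstoLocallyUniformlyOn_iff.2 fun ε hε z hz => ?_⟩
  obtain ⟨ρ, hρ, B, hB⟩ := hbdd z hz
  have hLip : ∀ᶠ n in (l : Filter ι), ∀ w ∈ Metric.ball z (ρ / 2),
      ‖G n w - G n z‖ ≤ |B| / (ρ / 4) * ‖w - z‖ := by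
    filter_upwards [hB] with n hn w hw
    refine (convex_ball z (ρ / 2)).norm_image_sub_le_of_norm_deriv_le (𝕜 := ℂ)
      (fun x _ => (hG n) x) (fun x hx => ?_) (Metric.mem_ball_self (by positivity)) hw
    refine Complex.norm_deriv_le_of_forall_mem_sphere_norm_le (by positivity)
      (hG n).diffContOnCl fun y hy => (hn y ?_).trans (le_abs_self B)
    rw [Metric.mem_sphere] at hy
    rw [Metric.mem_ball] at hx ⊢
    linarith [dist_triangle y x z]
  set L := |B| / (ρ / 4)
  have hL : 0 ≤ L := by positivity
  have hδ : 0 < min (ρ / 2) (ε / (4 * (L + 1))) := by positivity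
  refine ⟨U ∩ Metric.ball z (min (ρ / 2) (ε / (4 * (L + 1)))),
    inter_mem_nhdsWithin U (Metric.ball_mem_nhds z hδ), ?_⟩
  have hsmall : ∀ w ∈ Metric.ball z (min (ρ / 2) (ε / (4 * (L + 1)))),
      w ∈ Metric.ball z (ρ / 2) ∧ L * ‖w - z‖ ≤ ε / 4 := by
    intro w hw
    rw [Metric.mem_ball, lt_min_iff] at hw
    refine ⟨hw.1, ?_⟩
    have h2 := hw.2
    rw [dist_eq_norm, lt_div_iff₀ (by positivity)] at h2
    nlinarith [norm_nonneg (w - z)]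
  filter_upwards [hLip, Metric.tendsto_nhds.1 (hg z hz) (ε / 4) (by positivity)] with n hn hnz
  rintro w ⟨hwU, hw⟩
  obtain ⟨hw1, hw2⟩ := hsmall w hw
  have h1 : ‖g w - g z‖ ≤ L * ‖w - z‖ := by
    refine le_of_tendsto ((hg w hwU).sub (hg z hz)).norm ?_
    filter_upwards [hLip] with m hm using hm w hw1
  have h2 := hn w hw1
  rw [dist_eq_norm] at hnz ⊢
  calc ‖g w - G n w‖ = ‖(g w - g z) - (G n z - g z) - (G n w - G n z)‖ := by congr 1; ring
    _ ≤ ‖g w - g z‖ + ‖G n z - g z‖ + ‖G n w - G n z‖ :=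
      (norm_sub_le _ _).trans (by gcongr; exact norm_sub_le _ _)
    _ < ε := by linarith

/-- Entire functions with positive real part on a ball about the origin whose radius exceeds
`‖z‖` are bounded near `z` in terms of their value at the origin. -/
theorem exists_forall_norm_le_of_re_nonneg {z : ℂ} (hz : ‖z‖ < 1) (M : ℝ) :
    ∃ ρ > 0, ∃ B r : ℝ, r < 1 ∧ ∀ g : ℂ → ℂ, Differentiable ℂ g → ‖g 0‖ ≤ M →
      (∀ w ∈ Metric.ball 0 r, 0 ≤ (g w).re) → ∀ w ∈ Metric.ball z ρ, ‖g w‖ ≤ B := by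
  set s := (1 + ‖z‖) / 2 with hs
  set R := (1 + s) / 2 with hR
  have hz0 := norm_nonneg z
  refine ⟨s - ‖z‖, by linarith, 2 * 1 * s / (R - s) + M * (R + s) / (R - s), R, by linarith,
    fun g hg hM hre w hw => ?_⟩
  have hws : ‖w‖ ≤ s := by
    rw [Metric.mem_ball, dist_eq_norm] at hw
    linarith [norm_le_norm_add_norm_sub' w z]
  have hRs : 0 < R - s := by linarith
  have hM0 : 0 ≤ M := (norm_nonneg _).trans hM
  have h := Complex.borelCaratheodory (f := fun w => -g w) (M := 1) (R := R) (z := w) one_pos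
    hg.neg.differentiableOn (fun x hx => by
      have := hre x hx
      simp only [Set.mem_ofPred_eq, Complex.neg_re]
      linarith) (by linarith) (by rw [mem_ball_zero_iff]; linarith)
  simp only [norm_neg] at h
  refine h.trans ?_
  gcongr

theorem IsStrictWeight.exists_differentiableOn_norm_le_re {W : ℂ → ENNReal}
    (hW : IsStrictWeight W) {f : ℂ → ℂ} (hf : DifferentiableOn ℂ f unitDisk)
    (hK : (∫⁻ z in unitDisk, ENNReal.ofReal (‖deriv f z‖ ^ 2 + 2) * W z) < ⊤) :
    ∃ g : ℂ → ℂ, DifferentiableOn ℂ g unitDisk ∧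
      (∫⁻ z in unitDisk, ENNReal.ofReal (‖deriv g z‖ ^ 2) * W z) < ⊤ ∧
      ∀ z ∈ unitDisk, ‖f z‖ ≤ (g z).re := by
  set K := ∫⁻ z in unitDisk, ENNReal.ofReal (‖deriv f z‖ ^ 2 + 2) * W z with hKdef
  set R : ℕ → ℝ := fun n => 1 - 1 / (n + 2) with hR
  have hR1 : ∀ n, R n < 1 := fun n => by
    have : (0 : ℝ) < 1 / (n + 2) := by positivity
    simp only [hR]; linarith
  have hR0 : ∀ n, 1 / 2 ≤ R n := fun n => by
    have : (1 : ℝ) / (n + 2) ≤ 1 / 2 := by gcongr; linarith [n.cast_nonneg (α := ℝ)]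
    simp only [hR]; linarith
  have hRt : ∀ r < 1, ∀ᶠ n in Filter.atTop, r < R n := by
    intro r hr
    have h1 : Filter.Tendsto R Filter.atTop (nhds 1) := by
      have h2 : Filter.Tendsto (fun n : ℕ => (1 : ℝ) / ((n : ℝ) + 2)) Filter.atTop (nhds 0) :=
        tendsto_const_nhds.div_atTop
          (Filter.tendsto_atTop_add_const_right _ _ tendsto_natCast_atTop_atTop)
      simpa [hR] using h2.const_sub 1
    exact h1.eventually_const_lt hr
  choose G hG hG0 hGre hGint using fun n =>
    hW.exists_differentiable_norm_le_re hf (by linarith [hR0 n]) (hR1 n)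
  obtain ⟨B, hB⟩ : ∃ B, ∀ z ∈ Metric.closedBall (0 : ℂ) (1 / 2), ‖f z‖ ≤ B :=
    (isCompact_closedBall _ _).exists_bound_of_continuousOn
      (hf.continuousOn.mono (Metric.closedBall_subset_ball (by norm_num)))
  obtain ⟨M, hM⟩ : ∃ M, ∀ n, ‖G n 0‖ ≤ M := by
    set V := volume (Metric.ball (0 : ℂ) (1 / 2)) with hV
    have hVt : V < ⊤ := measure_ball_lt_top
    set T := 16 * (K + ENNReal.ofReal (B ^ 2) * V) with hT
    have hTt : T ≠ ⊤ := by
      refine ENNReal.mul_ne_top (by norm_num) (ENNReal.add_ne_top.2 ⟨hK.ne, ?_⟩)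
      exact ENNReal.mul_ne_top ENNReal.ofReal_ne_top hVt.ne
    refine ⟨√T.toReal, fun n => ?_⟩
    have h1 : ENNReal.ofReal ((G n 0).re ^ 2) ≤ T := by
      refine (ofReal_sq_re_le_lintegral_ball (hG n)).trans ?_
      rw [hT]
      gcongr
      calc ∫⁻ z in Metric.ball 0 (1 / 2), ENNReal.ofReal ((G n z).re ^ 2)
          ≤ ∫⁻ z in Metric.ball 0 (1 / 2),
              (ENNReal.ofReal ((G n z).re ^ 2 - ‖f z‖ ^ 2) + ENNReal.ofReal (B ^ 2)) := by
            refine setLIntegral_mono' Metric.isOpen_ball.measurableSet fun z hz => ?_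
            rw [← ENNReal.ofReal_add (sub_nonneg.2 ?_) (sq_nonneg B)]
            · refine ENNReal.ofReal_le_ofReal ?_
              have := pow_le_pow_left₀ (norm_nonneg _)
                (hB z (Metric.ball_subset_closedBall hz)) 2
              linarith
            · exact pow_le_pow_left₀ (norm_nonneg _)
                (hGre n z (Metric.ball_subset_ball (hR0 n) hz)) 2
        _ = (∫⁻ z in Metric.ball 0 (1 / 2), ENNReal.ofReal ((G n z).re ^ 2 - ‖f z‖ ^ 2)) +
              ENNReal.ofReal (B ^ 2) * V := by
            rw [lintegral_add_right _ measurable_const, setLIntegral_const]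
        _ ≤ K + ENNReal.ofReal (B ^ 2) * V := by
            gcongr
            exact (lintegral_mono_set (Metric.ball_subset_ball (hR0 n))).trans
              (le_add_self.trans (hGint n))
    have h2 : ‖G n 0‖ = |(G n 0).re| := by
      rw [← Complex.re_add_im (G n 0), hG0 n]
      simp
    rw [h2]
    refine Real.abs_le_sqrt ?_
    exact (ENNReal.ofReal_le_iff_le_toReal hTt).1 h1
  have hl : ((Filter.hyperfilter ℕ : Ultrafilter ℕ) : Filter ℕ) ≤ Filter.atTop :=
    Nat.hyperfilter_le_atTop
  obtain ⟨g, hg⟩ := exists_tendstoLocallyUniformlyOn_of_bounded (U := unitDisk)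
    (l := Filter.hyperfilter ℕ) hG (fun z hz => by
      obtain ⟨ρ, hρ, B, r, hr, h⟩ := exists_forall_norm_le_of_re_nonneg (mem_unitDisk.1 hz) M
      refine ⟨ρ, hρ, B, ?_⟩
      filter_upwards [hl (hRt r hr)] with n hn
      exact h (G n) (hG n) (hM n) fun w hw =>
        (norm_nonneg _).trans (hGre n w (Metric.ball_subset_ball hn.le hw)))
  have hgd : DifferentiableOn ℂ g unitDisk :=
    hg.differentiableOn (Filter.Eventually.of_forall fun n => (hG n).differentiableOn)
      isOpen_unitDisk
  have hg' := hg.deriv (Filter.Eventually.of_forall fun n => (hG n).differentiableOn)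
    isOpen_unitDisk
  refine ⟨g, hgd, ?_, fun z hz => ?_⟩
  · have hball : ∀ n, ∫⁻ z in Metric.ball 0 (R n), ENNReal.ofReal (‖deriv g z‖ ^ 2) * W z ≤
        4 * K + 2 * ∫⁻ z, W z := by
      intro n
      have hsub : Metric.closedBall (0 : ℂ) (R n) ⊆ unitDisk :=
        Metric.closedBall_subset_ball (hR1 n)
      have hu := (tendstoLocallyUniformlyOn_iff_forall_isCompact isOpen_unitDisk).1 hg' _ hsub
        (isCompact_closedBall _ _)
      obtain ⟨m, hm1, hm2⟩ := ((Metric.tendstoUniformlyOn_iff.1 hu 1 one_pos).and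
        (hl (hRt (R n) (hR1 n)))).exists
      calc ∫⁻ z in Metric.ball 0 (R n), ENNReal.ofReal (‖deriv g z‖ ^ 2) * W z
          ≤ ∫⁻ z in Metric.ball 0 (R n),
              (4 * (ENNReal.ofReal (1 / 2 * ‖deriv (G m) z‖ ^ 2) * W z) + 2 * W z) := by
            refine setLIntegral_mono' Metric.isOpen_ball.measurableSet fun z hz => ?_
            rw [← mul_assoc, ← add_mul]
            gcongr
            have h1 := hm1 z (Metric.ball_subset_closedBall hz)
            rw [dist_eq_norm] at h1
            have h2 : ‖deriv g z‖ ≤ ‖deriv (G m) z‖ + 1 := by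
              have h3 : ‖deriv g z - deriv (G m) z‖ < 1 := h1
              linarith [norm_le_norm_add_norm_sub' (deriv g z) (deriv (G m) z)]
            rw [show (4 : ENNReal) = ENNReal.ofReal 4 by simp,
              show (2 : ENNReal) = ENNReal.ofReal 2 by simp, ← ENNReal.ofReal_mul (by norm_num),
              ← ENNReal.ofReal_add (by positivity) (by norm_num)]
            refine ENNReal.ofReal_le_ofReal ?_
            nlinarith [norm_nonneg (deriv g z), sq_nonneg (‖deriv (G m) z‖ - 1)]
        _ = 4 * (∫⁻ z in Metric.ball 0 (R n), ENNReal.ofReal (1 / 2 * ‖deriv (G m) z‖ ^ 2) * W z)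
              + 2 * ∫⁻ z in Metric.ball 0 (R n), W z := by
            rw [lintegral_add_right _ (hW.measurable.const_mul 2),
              lintegral_const_mul' _ _ (by norm_num), lintegral_const_mul' _ _ (by norm_num)]
        _ ≤ 4 * K + 2 * ∫⁻ z, W z := by
            gcongr
            · exact (lintegral_mono_set (Metric.ball_subset_ball hm2.le)).trans
                (le_self_add.trans (hGint m))
            · exact Measure.restrict_le_self
    have hU : unitDisk = ⋃ n, Metric.ball (0 : ℂ) (R n) := by
      ext z
      simp only [Set.mem_iUnion, mem_ball_zero_iff, mem_unitDisk]
      exact ⟨fun h => (hRt _ h).exists, fun ⟨n, hn⟩ => hn.trans (hR1 n)⟩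
    have hmono : Monotone fun n => Metric.ball (0 : ℂ) (R n) := by
      intro a b hab
      refine Metric.ball_subset_ball ?_
      simp only [hR]
      gcongr
    rw [hU, setLIntegral_iUnion_of_directed _ hmono.directed_le]
    refine (iSup_le hball).trans_lt (ENNReal.add_lt_top.2 ⟨?_, ?_⟩)
    · exact ENNReal.mul_lt_top (by simp) hK
    · exact ENNReal.mul_lt_top (by simp) hW.lintegral_ne_top.lt_top
  · have h1 : Filter.Tendsto (fun n => (G n z).re) (Filter.hyperfilter ℕ : Filter ℕ)
        (nhds (g z).re) :=
      (Complex.continuous_re.tendsto _).comp (hg.tendsto_at hz)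
    refine ge_of_tendsto h1 ?_
    filter_upwards [hl (hRt _ (mem_unitDisk.1 hz))] with n hn
    exact hGre n z (mem_ball_zero_iff.2 hn)

theorem SuperharmonicOn.exists_finiteEnergy_norm_le_re {ω : ℂ → ℝ} (hω : SuperharmonicOn ω)
    (hpos : ∀ z ∈ unitDisk, 0 < ω z) {f : ℂ → ℂ} (hf : FiniteEnergy ω f) :
    ∃ g, FiniteEnergy ω g ∧ ∀ z ∈ unitDisk, ‖f z‖ ≤ (g z).re := by
  obtain ⟨W, hW, hωW, C, hWω⟩ := hω.exists_isStrictWeight hpos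
  have hm := measurableSet_unitDisk
  obtain ⟨g, hg, hgW, hfg⟩ := hW.exists_differentiableOn_norm_le_re hf.1 <| by
    calc ∫⁻ z in unitDisk, ENNReal.ofReal (‖deriv f z‖ ^ 2 + 2) * W z
        ≤ ∫⁻ z in unitDisk, (ENNReal.ofReal C * ENNReal.ofReal (‖deriv f z‖ ^ 2 * ω z)
            + 2 * W z) := by
          refine setLIntegral_mono' hm fun z hz => ?_
          rw [ENNReal.ofReal_add (by positivity) (by norm_num), add_mul,
            ENNReal.ofReal_mul (by positivity), mul_left_comm,
            ← ENNReal.ofReal_mul' (hpos z hz).le]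
          gcongr
          · exact hWω z hz
          · simp
      _ = ENNReal.ofReal C * (∫⁻ z in unitDisk, ENNReal.ofReal (‖deriv f z‖ ^ 2 * ω z))
            + 2 * ∫⁻ z in unitDisk, W z := by
          rw [lintegral_add_right _ (hW.measurable.const_mul 2),
            lintegral_const_mul' _ _ ENNReal.ofReal_ne_top, lintegral_const_mul' _ _ (by norm_num)]
      _ < ⊤ := ENNReal.add_lt_top.2 ⟨ENNReal.mul_lt_top ENNReal.ofReal_lt_top hf.2,
          ENNReal.mul_lt_top (by simp) ((setLIntegral_le_lintegral _ _).trans_lt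
            hW.lintegral_ne_top.lt_top)⟩
  refine ⟨g, ⟨hg, lt_of_le_of_lt (setLIntegral_mono' hm fun z hz => ?_) hgW⟩, hfg⟩
  rw [ENNReal.ofReal_mul (by positivity)]
  gcongr
  exact hωW z hz

/-- **GKZ theorem for weighted Dirichlet spaces.** Let `ω` be a positive superharmonic
function on the unit disk.  A ℂ-linear functional `Λ` on `𝒟_ω` (not assumed continuous)
with `Λ 1 = 1` that is non-zero on every nowhere-vanishing function in `𝒟_ω` is
evaluation at some point `w` of the unit disk. -/
theorem gkz_dirichlet (ω : ℂ → ℝ)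
    (hωpos : ∀ z ∈ unitDisk, 0 < ω z) (hω : SuperharmonicOn ω)
    (Λ : (unitDisk → ℂ) → ℂ)
    (hadd : ∀ f g : unitDisk → ℂ, dirichletMem ω f → dirichletMem ω g →
      Λ (f + g) = Λ f + Λ g)
    (hsmul : ∀ (c : ℂ) (f : unitDisk → ℂ), dirichletMem ω f → Λ (c • f) = c * Λ f)
    (h1 : Λ 1 = 1)
    (hne : ∀ g : unitDisk → ℂ, dirichletMem ω g → (∀ z : unitDisk, g z ≠ 0) → Λ g ≠ 0) :
    ∃ w : unitDisk, ∀ f : unitDisk → ℂ, dirichletMem ω f → Λ f = f w := by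
  have hint := hω.isIntegrableWeight hωpos
  have hmem : ∀ {F : ℂ → ℂ}, FiniteEnergy ω F → dirichletMem ω fun z => F z :=
    fun {F} hF => ⟨F, hF.1, fun _ => rfl, hF.2⟩
  have hL : IsNonvanishingFunctional ω fun F => Λ fun z : unitDisk => F z :=
    { congr := fun f g hfg => congrArg Λ (funext fun z => hfg z.2)
      add := fun f g hf hg => hadd _ _ (hmem hf) (hmem hg)
      const_mul := fun c f hf => hsmul c _ (hmem hf)
      one := h1
      ne_zero := fun f hf hne0 => hne _ (hmem hf) fun z => hne0 z z.2 }
  refine ⟨⟨_, hL.apply_id_mem hint⟩, fun f hf => ?_⟩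
  obtain ⟨F, hFd, hfF, hFint⟩ := hf
  have hF : FiniteEnergy ω F := ⟨hFd, hFint⟩
  obtain ⟨g, hg, hFg⟩ := hω.exists_finiteEnergy_norm_le_re hωpos hF
  rw [hfF, show f = fun z : unitDisk => F z from funext hfF]
  exact hL.eq_apply hint hF hg hFg
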